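/- arXiv:1312.4446 — 8 statements merged into one kernel-verified Lean document; each statement's English description precedes it below -/
import Mathlib

section
/- Define, for integers s and k, H₀(s,k) := (1/(2π)) · ∫_{−π}^{π} (cos θ/(1+|sin θ|))^{|k|} · exp(−i·s·θ) · (1 − exp(−2iθ))^(−1/2) dθ. Then H₀ satisfies: (a) for all integers s,k with k ≠ 0 or s ≤ −1, H₀(s+1,k+1) + H₀(s+1,k−1) + H₀(s−1,k+1) + H₀(s−1,k−1) = 4·H₀(s,k); (b) H₀(0,0) = 1 and H₀(s,0) = 0 for every integer s ≥ 1; (c) for every ε > 0 there exists R such that ‖H₀(s,k)‖ ≤ ε whenever |s| + |k| ≥ R. Moreover H₀ is the unique function L : ℤ × ℤ → ℂ satisfying (a), (b) and (c). -/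
/-- The discrete harmonic measure of the tip of the slit in the slit lattice plane,
`H₀(s,k) = (1/(2π)) ∫_{−π}^{π} (cos θ/(1+|sin θ|))^{|k|} e^{−isθ} (1−e^{−2iθ})^{−1/2} dθ`. -/
noncomputable def H0 (s k : ℤ) : ℂ :=
  (1 / (2 * (Real.pi : ℂ))) *
    ∫ θ in (-Real.pi)..Real.pi,
      ((Real.cos θ / (1 + |Real.sin θ|) : ℝ) : ℂ) ^ k.natAbs *
        Complex.exp (-Complex.I * (s : ℂ) * (θ : ℂ)) *
        ((1 : ℂ) - Complex.exp (-2 * Complex.I * (θ : ℂ))) ^ (-(1 / 2) : ℂ)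

open Real MeasureTheory Filter Topology Set

noncomputable def hmW (θ : ℝ) : ℂ :=
  ((1 : ℂ) - Complex.exp (-2 * Complex.I * (θ : ℂ))) ^ (-(1 / 2) : ℂ)

noncomputable def hmL (θ : ℝ) : ℝ := Real.cos θ / (1 + |Real.sin θ|)

theorem hm_norm_u (θ : ℝ) : ‖(1 : ℂ) - Complex.exp (-2 * Complex.I * (θ : ℂ))‖ = 2 * |Real.sin θ| := by
  have h : (1 : ℂ) - Complex.exp (-2 * Complex.I * (θ : ℂ)) =
      Complex.exp ((-θ : ℝ) * Complex.I) * (2 * Complex.I * ((Real.sin θ : ℝ) : ℂ)) := by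
    have e1 : Complex.exp (-2 * Complex.I * (θ : ℂ)) =
        Complex.exp ((-θ : ℝ) * Complex.I) * Complex.exp ((-θ : ℝ) * Complex.I) := by
      rw [← Complex.exp_add]; congr 1; push_cast; ring
    have e2 : Complex.exp ((-θ : ℝ) * Complex.I) = Complex.cos θ - Complex.sin θ * Complex.I := by
      rw [Complex.exp_mul_I]; push_cast; rw [Complex.cos_neg, Complex.sin_neg]; ring
    rw [e1, e2, Complex.ofReal_sin]
    have h1 := Complex.sin_sq_add_cos_sq (θ : ℂ)
    have h2 := Complex.I_sq
    linear_combination (-1 : ℂ) * h1 - Complex.sin (θ:ℂ)^2 * h2 + 2 * Complex.sin (θ:ℂ)^2 * h2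
  rw [h, norm_mul, Complex.norm_exp_ofReal_mul_I, norm_mul, norm_mul, Complex.norm_I, Complex.norm_real]
  simp

theorem hm_norm_W (θ : ℝ) : ‖hmW θ‖ = (2 * |Real.sin θ|) ^ (-(1/2) : ℝ) := by
  rw [hmW, ← hm_norm_u, ← Complex.norm_cpow_real]
  norm_num

theorem hm_meas_W : Measurable hmW := by
  unfold hmW
  fun_prop

theorem hm_int_aux : IntervalIntegrable (fun θ : ℝ => (2 * |Real.sin θ|) ^ (-(1/2) : ℝ)) volume (-π) π := by
  have hm : Measurable (fun θ : ℝ => (2 * |Real.sin θ|) ^ (-(1/2) : ℝ)) := by fun_prop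
  have h1 : IntervalIntegrable (fun θ : ℝ => (2 * |Real.sin θ|) ^ (-(1/2) : ℝ)) volume 0 (π/2) := by
    have h0 : IntervalIntegrable (fun θ : ℝ => (4 / π) ^ (-(1/2) : ℝ) * θ ^ (-(1/2) : ℝ)) volume 0 (π/2) :=
      (intervalIntegral.intervalIntegrable_rpow' (by norm_num)).const_mul _
    refine h0.mono_fun' hm.aestronglyMeasurable ?_
    rw [uIoc_of_le (by positivity)]
    refine (ae_restrict_mem measurableSet_Ioc).mono fun x hx => ?_
    have hx0 : 0 < x := hx.1
    have h2 := Real.mul_le_sin hx0.le hx.2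
    have hpi := Real.pi_pos
    have h3 : 0 < 2 / π * x := by positivity
    dsimp only
    rw [← Real.mul_rpow (by positivity) hx0.le, Real.norm_of_nonneg (by positivity), abs_of_pos (by linarith)]
    refine Real.rpow_le_rpow_of_nonpos (by positivity) ?_ (by norm_num)
    calc 4 / π * x = 2 * (2 / π * x) := by ring
      _ ≤ _ := by linarith
  have h2 : IntervalIntegrable (fun θ : ℝ => (2 * |Real.sin θ|) ^ (-(1/2) : ℝ)) volume (π/2) π := by
    have := (h1.comp_sub_left π).symm
    simp only [Real.sin_pi_sub] at this
    convert! this using 1 <;> ring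
  have h3 := h1.trans h2
  have h4 : IntervalIntegrable (fun θ : ℝ => (2 * |Real.sin θ|) ^ (-(1/2) : ℝ)) volume (-π) 0 := by
    have := (h3.comp_sub_left 0).symm
    simpa using this
  exact h4.trans h3

theorem hm_int_W : IntervalIntegrable hmW volume (-π) π := by
  refine hm_int_aux.mono_fun' hm_meas_W.aestronglyMeasurable (Eventually.of_forall fun x => ?_)
  exact (hm_norm_W x).le

theorem hm_cont_L : Continuous hmL := by
  unfold hmL
  refine Continuous.div (by fun_prop) (by fun_prop) fun x => ?_
  positivity

theorem hm_int (s : ℤ) (n : ℕ) : IntervalIntegrable (fun θ : ℝ =>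
    ((hmL θ : ℝ) : ℂ) ^ n * Complex.exp (-Complex.I * (s : ℂ) * (θ : ℂ)) * hmW θ) volume (-π) π := by
  refine hm_int_W.continuousOn_mul (Continuous.continuousOn ?_)
  have := hm_cont_L
  fun_prop

theorem hm_H0 (s k : ℤ) : H0 s k = (1 / (2 * (Real.pi : ℂ))) *
    ∫ θ in (-Real.pi)..Real.pi,
      ((hmL θ : ℝ) : ℂ) ^ k.natAbs * Complex.exp (-Complex.I * (s : ℂ) * (θ : ℂ)) * hmW θ := rfl

theorem hm_L_id (θ : ℝ) : Real.cos θ * (hmL θ ^ 2 + 1) = 2 * hmL θ := by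
  have h : 1 + |Real.sin θ| ≠ 0 := by positivity
  have h1 := Real.sin_sq_add_cos_sq θ
  have h2 := sq_abs (Real.sin θ)
  unfold hmL
  field_simp
  linear_combination Real.cos θ * (h1 + h2)

theorem hm_L_id2 (θ : ℝ) : Real.cos θ * hmL θ = 1 - |Real.sin θ| := by
  have h : 1 + |Real.sin θ| ≠ 0 := by positivity
  have h1 := Real.sin_sq_add_cos_sq θ
  have h2 := sq_abs (Real.sin θ)
  unfold hmL
  field_simp
  linear_combination h1 + h2

theorem hm_L_le (θ : ℝ) : |hmL θ| ≤ 1 := by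
  have h : 0 < 1 + |Real.sin θ| := by positivity
  unfold hmL
  rw [abs_div, abs_of_pos h, div_le_one h]
  linarith [Real.abs_cos_le_one θ, abs_nonneg (Real.sin θ)]

theorem hm_L_lt (θ : ℝ) (hs : Real.sin θ ≠ 0) : |hmL θ| < 1 := by
  have h : 0 < 1 + |Real.sin θ| := by positivity
  unfold hmL
  rw [abs_div, abs_of_pos h, div_lt_one h]
  linarith [Real.abs_cos_le_one θ, abs_pos.2 hs]

/- decay in k -/
theorem hm_k : Tendsto (fun n : ℕ => ∫ θ in (-π)..π, |hmL θ| ^ n * ‖hmW θ‖) atTop (𝓝 0) := by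
  have : (0 : ℝ) = ∫ θ in (-π)..π, (0:ℝ) := by simp
  rw [this]
  have hc := hm_cont_L.measurable
  have hw := hm_meas_W
  refine intervalIntegral.tendsto_integral_filter_of_dominated_convergence (fun θ => ‖hmW θ‖) ?_ ?_ hm_int_W.norm ?_
  · refine Eventually.of_forall fun n => Measurable.aestronglyMeasurable ?_
    fun_prop
  · refine Eventually.of_forall fun n => Eventually.of_forall fun θ _ => ?_
    rw [norm_mul, norm_norm, norm_pow, Real.norm_eq_abs, abs_abs]
    exact mul_le_of_le_one_left (norm_nonneg _) (pow_le_one₀ (abs_nonneg _) (hm_L_le θ))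
  · refine Eventually.of_forall fun θ _ => ?_
    by_cases h : Real.sin θ = 0
    · have : ‖hmW θ‖ = 0 := by rw [hm_norm_W, h]; simp
      simp [this]
    · have := (tendsto_pow_atTop_nhds_zero_of_lt_one (abs_nonneg _) (hm_L_lt θ h)).mul_const ‖hmW θ‖
      simpa using this

theorem hm_bound_k (s k : ℤ) : ‖H0 s k‖ ≤ ∫ θ in (-π)..π, |hmL θ| ^ k.natAbs * ‖hmW θ‖ := by
  have hpi := Real.pi_gt_three
  rw [hm_H0, norm_mul]
  have h1 : ‖(1 / (2 * (Real.pi : ℂ)))‖ ≤ 1 := by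
    rw [norm_div, norm_mul, Complex.norm_real, Real.norm_of_nonneg (by linarith)]
    simp only [norm_one, Complex.norm_ofNat]
    rw [div_le_one (by positivity)]; linarith
  refine (mul_le_of_le_one_left (norm_nonneg _) h1).trans ?_
  refine (intervalIntegral.norm_integral_le_integral_norm (by linarith)).trans (le_of_eq ?_)
  congr 1; ext θ
  rw [norm_mul, norm_mul, norm_pow, Complex.norm_real, Real.norm_eq_abs]
  have : -Complex.I * (s : ℂ) * (θ : ℂ) = ((-s * θ : ℝ) : ℂ) * Complex.I := by push_cast; ring
  rw [this, Complex.norm_exp_ofReal_mul_I, mul_one]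

theorem hm_s (k : ℤ) : Tendsto (fun s : ℤ => H0 s k) cofinite (𝓝 0) := by
  have h := Real.tendsto_integral_exp_smul_cocompact
    ((Ioc (-π) π).indicator fun θ => ((hmL θ : ℝ) : ℂ) ^ k.natAbs * hmW θ)
  have h2 : Tendsto (fun s : ℤ => (s : ℝ) * (2 * π)⁻¹) cofinite (cocompact ℝ) :=
    (Homeomorph.mulRight₀ ((2 * π)⁻¹) (by positivity)).isClosedEmbedding.tendsto_cocompact.comp
      Int.tendsto_coe_cofinite
  have h3 := (h.comp h2).const_mul (1 / (2 * (Real.pi : ℂ)))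
  rw [mul_zero] at h3
  refine h3.congr fun s => ?_
  rw [hm_H0, intervalIntegral.integral_of_le (by linarith [Real.pi_pos]),
    ← integral_indicator measurableSet_Ioc]
  simp only [Function.comp]
  congr 2; ext θ
  by_cases hθ : θ ∈ Ioc (-π) π
  · rw [indicator_of_mem hθ, indicator_of_mem hθ, Circle.smul_def, Real.fourierChar_apply]
    have : ((2 * π * -(θ * (↑s * (2 * π)⁻¹)) : ℝ) : ℂ) * Complex.I = -Complex.I * (s : ℂ) * (θ : ℂ) := by
      have hp : (π : ℂ) ≠ 0 := by exact_mod_cast Real.pi_ne_zero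
      push_cast
      field_simp
    rw [this, smul_eq_mul]; ring
  · simp [indicator_of_notMem hθ]

theorem hm_c : ∀ ε : ℝ, 0 < ε → ∃ R : ℕ, ∀ s k : ℤ, (R : ℤ) ≤ |s| + |k| → ‖H0 s k‖ ≤ ε := by
  intro ε hε
  obtain ⟨K, hK⟩ := eventually_atTop.1 (hm_k.eventually (gt_mem_nhds hε))
  have hS : ∀ k : ℤ, ∃ S : ℕ, ∀ s : ℤ, S ≤ s.natAbs → ‖H0 s k‖ ≤ ε := by
    intro k
    have h1 : ∀ᶠ s in cofinite, ‖H0 s k‖ < ε := by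
      have := (hm_s k).norm
      rw [norm_zero] at this
      exact this.eventually (gt_mem_nhds hε)
    have hf : {s : ℤ | ¬ ‖H0 s k‖ < ε}.Finite := h1
    obtain ⟨B, hB⟩ := (hf.image Int.natAbs).bddAbove
    refine ⟨B + 1, fun s hs => ?_⟩
    by_contra hc
    have : s.natAbs ≤ B := hB ⟨s, fun h => hc h.le, rfl⟩
    omega
  choose S hS using hS
  refine ⟨K + ∑ k ∈ Finset.Icc (-(K:ℤ)) K, S k, fun s k hsk => ?_⟩
  by_cases hk : K ≤ k.natAbs
  · exact (hm_bound_k s k).trans (hK _ hk).le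
  · apply hS k s
    have : S k ≤ ∑ k ∈ Finset.Icc (-(K:ℤ)) K, S k :=
      Finset.single_le_sum (f := S) (fun _ _ => Nat.zero_le _) (Finset.mem_Icc.2 (by omega))
    rw [Int.abs_eq_natAbs, Int.abs_eq_natAbs] at hsk
    have hsk' : K + ∑ k ∈ Finset.Icc (-(K:ℤ)) K, S k ≤ s.natAbs + k.natAbs := by exact_mod_cast hsk
    omega

theorem hm_uniq (D : ℤ × ℤ → ℂ)
    (ha : ∀ s k : ℤ, (k ≠ 0 ∨ s ≤ -1) →
        D (s + 1, k + 1) + D (s + 1, k - 1) + D (s - 1, k + 1) + D (s - 1, k - 1)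
          = 4 * D (s, k))
    (hb : ∀ s : ℤ, 0 ≤ s → D (s, 0) = 0)
    (hc : ∀ ε : ℝ, 0 < ε → ∃ R : ℕ, ∀ s k : ℤ, (R : ℤ) ≤ |s| + |k| → ‖D (s, k)‖ ≤ ε) (p : ℤ × ℤ) :
    D p = 0 := by
  by_contra hp
  have hp' : 0 < ‖D p‖ := norm_pos_iff.2 hp
  obtain ⟨R, hR⟩ := hc (‖D p‖ / 2) (by positivity)
  have hbox : ∀ q : ℤ × ℤ, ‖D p‖ ≤ ‖D q‖ → q ∈ Finset.Icc (-(R:ℤ)) R ×ˢ Finset.Icc (-(R:ℤ)) R := by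
    rintro ⟨s, k⟩ hq
    have : ¬ (R : ℤ) ≤ |s| + |k| := fun h => by linarith [hR s k h]
    simp only [Finset.mem_product, Finset.mem_Icc]
    have := le_abs_self s
    have := neg_abs_le s
    have := le_abs_self k
    have := neg_abs_le k
    omega
  obtain ⟨m, -, hm⟩ := Finset.exists_max_image _ (fun q => ‖D q‖) ⟨p, hbox p le_rfl⟩
  have hpm := hm p (hbox p le_rfl)
  have hmax : ∀ q, ‖D q‖ ≤ ‖D m‖ := fun q => by
    by_cases h : ‖D p‖ ≤ ‖D q‖
    · exact hm q (hbox q h)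
    · linarith
  obtain ⟨n, hn, hn2⟩ := Finset.exists_max_image
    ((Finset.Icc (-(R:ℤ)) R ×ˢ Finset.Icc (-(R:ℤ)) R).filter fun q => ‖D q‖ = ‖D m‖) (fun q => q.1)
    ⟨m, Finset.mem_filter.2 ⟨hbox m hpm, rfl⟩⟩
  obtain ⟨s, k⟩ := n
  have hnm := (Finset.mem_filter.1 hn).2
  have hoff : k ≠ 0 ∨ s ≤ -1 := by
    by_contra hcon
    push Not at hcon
    obtain ⟨rfl, h⟩ := hcon
    rw [hb s (by omega), norm_zero] at hnm
    linarith
  have h1 : ‖D (s+1, k+1)‖ = ‖D m‖ := by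
    refine le_antisymm (hmax _) ?_
    have e := congrArg norm (ha s k hoff)
    rw [norm_mul, hnm] at e
    simp only [Complex.norm_ofNat] at e
    have t1 := norm_add_le (D (s + 1, k + 1) + D (s + 1, k - 1) + D (s - 1, k + 1)) (D (s - 1, k - 1))
    have t2 := norm_add_le (D (s + 1, k + 1) + D (s + 1, k - 1)) (D (s - 1, k + 1))
    have t3 := norm_add_le (D (s + 1, k + 1)) (D (s + 1, k - 1))
    linarith [hmax (s+1,k-1), hmax (s-1,k+1), hmax (s-1,k-1)]
  have h2 := hn2 (s+1, k+1) (Finset.mem_filter.2 ⟨hbox _ (by rw [h1]; exact hpm), h1⟩)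
  simp at h2

theorem hm_mean (g : ℂ → ℂ) (b : ℝ → ℝ) (hg : DifferentiableOn ℂ g (Metric.ball 0 1))
    (hb : IntervalIntegrable b volume (-π) π)
    (hbd : ∀ r : ℝ, 0 < r → r < 1 → ∀ θ : ℝ, Real.sin θ ≠ 0 → ‖g (r * Complex.exp (θ * Complex.I))‖ ≤ b θ)
    (hlim : ∀ θ : ℝ, Real.sin θ ≠ 0 → ContinuousAt g (Complex.exp (θ * Complex.I))) :
    ∫ θ in (-π)..π, g (Complex.exp (θ * Complex.I)) = 2 * π * g 0 := by
  have hae : ∀ᵐ θ : ℝ, Real.sin θ ≠ 0 := by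
    have hcount : {θ : ℝ | Real.sin θ = 0}.Countable := by
      refine (countable_range (fun n : ℤ => (n : ℝ) * π)).mono ?_
      intro θ hθ
      obtain ⟨n, hn⟩ := Real.sin_eq_zero_iff.1 hθ
      exact ⟨n, hn⟩
    have := hcount.measure_zero volume
    simpa [ae_iff] using this
  have hev : ∀ᶠ r : ℝ in 𝓝[<] (1:ℝ), 0 < r ∧ r < 1 := by
    have : Ioo (0:ℝ) 1 ∈ 𝓝[<] (1:ℝ) := Ioo_mem_nhdsLT (by norm_num)
    exact this
  have hmem : ∀ r : ℝ, 0 < r → r < 1 → ∀ θ : ℝ, (r : ℂ) * Complex.exp (θ * Complex.I) ∈ Metric.ball (0:ℂ) 1 := by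
    intro r h0 h1 θ
    rw [mem_ball_zero_iff, norm_mul, Complex.norm_exp_ofReal_mul_I, Complex.norm_real,
      Real.norm_of_nonneg h0.le]
    linarith
  have hval : ∀ r : ℝ, 0 < r → r < 1 →
      ∫ θ in (-π)..π, g (r * Complex.exp (θ * Complex.I)) = 2 * π * g 0 := by
    intro r h0 h1
    have hd : DiffContOnCl ℂ g (Metric.ball 0 |r|) := by
      apply DifferentiableOn.diffContOnCl
      rw [closure_ball _ (by simpa using h0.ne')]
      refine hg.mono (Metric.closedBall_subset_ball ?_)
      rwa [abs_of_pos h0]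
    have h2 := hd.circleAverage
    rw [Real.circleAverage_def] at h2
    have hper : Function.Periodic (fun θ : ℝ => g (circleMap 0 r θ)) (2 * π) := by
      intro θ
      simp only
      rw [periodic_circleMap 0 r θ]
    have h3 := hper.intervalIntegral_add_eq (-π) 0
    rw [show -π + 2 * π = π by ring, zero_add] at h3
    rw [← h3] at h2
    simp only [circleMap_zero] at h2
    rw [← h2, Complex.real_smul]
    have hp : (π : ℂ) ≠ 0 := by exact_mod_cast Real.pi_ne_zero
    rw [← mul_assoc]
    have h5 : (2 * (π:ℂ)) * (((2 * π)⁻¹ : ℝ) : ℂ) = 1 := by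
      push_cast
      exact mul_inv_cancel₀ (mul_ne_zero two_ne_zero hp)
    rw [h5, one_mul]
  have ht : Tendsto (fun r : ℝ => ∫ θ in (-π)..π, g (r * Complex.exp (θ * Complex.I))) (𝓝[<] 1)
      (𝓝 (∫ θ in (-π)..π, g (Complex.exp (θ * Complex.I)))) := by
    refine intervalIntegral.tendsto_integral_filter_of_dominated_convergence b ?_ ?_ hb ?_
    · filter_upwards [hev] with r hr
      refine Continuous.aestronglyMeasurable ?_
      exact hg.continuousOn.comp_continuous (by fun_prop) (hmem r hr.1 hr.2)
    · filter_upwards [hev] with r hr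
      filter_upwards [hae] with θ hθ _
      exact hbd r hr.1 hr.2 θ hθ
    · filter_upwards [hae] with θ hθ _
      have h1 : Tendsto (fun r : ℝ => (r : ℂ) * Complex.exp (θ * Complex.I)) (𝓝[<] 1)
          (𝓝 (Complex.exp (θ * Complex.I))) := by
        have : Continuous (fun r : ℝ => (r : ℂ) * Complex.exp (θ * Complex.I)) := by fun_prop
        have := (this.tendsto 1).mono_left (nhdsWithin_le_nhds (s := Iio 1))
        simpa using this
      exact (hlim θ hθ).tendsto.comp h1
  have ht2 : Tendsto (fun r : ℝ => ∫ θ in (-π)..π, g (r * Complex.exp (θ * Complex.I))) (𝓝[<] 1)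
      (𝓝 (2 * π * g 0)) := by
    refine tendsto_const_nhds.congr' ?_
    filter_upwards [hev] with r hr
    exact (hval r hr.1 hr.2).symm
  exact tendsto_nhds_unique ht ht2

theorem hm_slit {z : ℂ} (hz : ‖z‖ ≤ 1) (h : z ^ 2 ≠ 1) : 0 < (1 - z ^ 2).re := by
  have h1 : ‖z ^ 2‖ ≤ 1 := by rw [norm_pow]; exact pow_le_one₀ (norm_nonneg _) hz
  have h2 : (z^2).re ≤ 1 := (Complex.re_le_norm _).trans h1
  rw [Complex.sub_re, Complex.one_re, sub_pos]
  refine lt_of_le_of_ne h2 fun he => h ?_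
  have h3 : ‖z^2‖ ^ 2 ≤ 1 := pow_le_one₀ (norm_nonneg _) h1
  rw [Complex.sq_norm, Complex.normSq_apply, he] at h3
  have h4 : (z^2).im = 0 := by nlinarith [mul_self_nonneg (z^2).im]
  apply Complex.ext <;> simp [he, h4]

theorem hm_exp_sq (θ : ℝ) : Complex.exp (θ * Complex.I) ^ 2 = Complex.exp (-2 * Complex.I * ((-θ : ℝ) : ℂ)) := by
  rw [← Complex.exp_nat_mul]; congr 1; push_cast; ring

theorem hm_exp_ne (θ : ℝ) (h : Real.sin θ ≠ 0) : Complex.exp (θ * Complex.I) ^ 2 ≠ 1 := by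
  rw [hm_exp_sq]
  intro he
  have := hm_norm_u (-θ)
  rw [he] at this
  simp at this
  exact h this

theorem hm_gdiff (n : ℕ) (a : ℂ) {z : ℂ} (hz : ‖z‖ ≤ 1) (h : z ^ 2 ≠ 1) :
    DifferentiableAt ℂ (fun z : ℂ => z ^ n * (1 - z ^ 2) ^ a) z := by
  have hs : (1 - z^2) ∈ Complex.slitPlane := Or.inl (hm_slit hz h)
  refine DifferentiableAt.mul (by fun_prop) ?_
  exact DifferentiableAt.cpow_const (by fun_prop) hs

theorem hm_ball_ne {z : ℂ} (hz : ‖z‖ < 1) : z ^ 2 ≠ 1 := by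
  intro h
  have := congrArg norm h
  rw [norm_pow, norm_one] at this
  have := pow_lt_one₀ (norm_nonneg z) hz two_ne_zero
  linarith

theorem hm_mean_pow (n : ℕ) (a : ℝ) (b : ℝ → ℝ) (hb : IntervalIntegrable b volume (-π) π)
    (hbd : ∀ r : ℝ, 0 < r → r < 1 → ∀ θ : ℝ, Real.sin θ ≠ 0 →
      ‖1 - (r * Complex.exp (θ * Complex.I)) ^ 2‖ ^ a ≤ b θ) :
    ∫ θ in (-π)..π, Complex.exp (θ * Complex.I) ^ n * (1 - Complex.exp (θ * Complex.I) ^ 2) ^ (a : ℂ)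
      = 2 * (π : ℂ) * 0 ^ n := by
  have := hm_mean (fun z : ℂ => z ^ n * (1 - z ^ 2) ^ (a : ℂ)) b ?_ hb ?_ ?_
  · simpa using this
  · intro z hz
    rw [mem_ball_zero_iff] at hz
    exact (hm_gdiff n a hz.le (hm_ball_ne hz)).differentiableWithinAt
  · intro r h0 h1 θ hθ
    rw [norm_mul, norm_pow, Complex.norm_cpow_real]
    refine le_trans (mul_le_of_le_one_left (by positivity) (pow_le_one₀ (norm_nonneg _) ?_)) (hbd r h0 h1 θ hθ)
    rw [norm_mul, Complex.norm_exp_ofReal_mul_I, Complex.norm_real, Real.norm_of_nonneg h0.le]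
    linarith
  · intro θ hθ
    exact (hm_gdiff n a (Complex.norm_exp_ofReal_mul_I θ).le (hm_exp_ne θ hθ)).continuousAt

theorem hm_b (n : ℕ) : H0 n 0 = 0 ^ n := by
  have h := hm_mean_pow n (-(1/2)) (fun θ => (1/2 : ℝ) ^ (-(1/2) : ℝ) * (2 * |Real.sin θ|) ^ (-(1/2) : ℝ))
    (hm_int_aux.const_mul _) ?_
  · rw [hm_H0]
    have hneg := intervalIntegral.integral_comp_neg (a := -π) (b := π) (fun θ : ℝ =>
      Complex.exp (θ * Complex.I) ^ n * (1 - Complex.exp (θ * Complex.I) ^ 2) ^ ((-(1/2) : ℝ) : ℂ))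
    rw [neg_neg] at hneg
    rw [← hneg] at h
    have h2 : ∫ θ in (-π)..π, ((hmL θ : ℝ) : ℂ) ^ (0:ℤ).natAbs * Complex.exp (-Complex.I * ((n:ℤ) : ℂ) * (θ : ℂ)) * hmW θ
        = 2 * (π : ℂ) * 0 ^ n := by
      rw [← h]
      congr 1; ext θ
      rw [hm_exp_sq, neg_neg, hmW, ← Complex.exp_nat_mul]
      simp only [Int.natAbs_zero, pow_zero, one_mul]
      congr 2
      · push_cast; ring
      · push_cast; ring
    rw [h2]
    have hp : (π : ℂ) ≠ 0 := by exact_mod_cast Real.pi_ne_zero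
    field_simp
  · intro r h0 h1 θ hθ
    rw [← Real.mul_rpow (by positivity) (by positivity)]
    refine Real.rpow_le_rpow_of_nonpos ?_ ?_ (by norm_num)
    · have := abs_pos.2 hθ
      positivity
    · have e := hm_norm_u (-θ)
      rw [Real.sin_neg, abs_neg, ← hm_exp_sq] at e
      rw [← e, mul_pow]
      set w := Complex.exp (θ * Complex.I) ^ 2 with hw
      have hwn : ‖w‖ = 1 := by rw [hw, norm_pow, Complex.norm_exp_ofReal_mul_I, one_pow]
      have hr2 : r ^ 2 < 1 := pow_lt_one₀ h0.le h1 two_ne_zero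
      have t1 : ‖1 - w‖ ≤ ‖1 - (r:ℂ)^2 * w‖ + (1 - r^2) := by
        have : 1 - w = (1 - (r:ℂ)^2 * w) - ((1 - r^2 : ℝ) : ℂ) * w := by push_cast; ring
        rw [this]
        refine (norm_sub_le _ _).trans (le_of_eq ?_)
        rw [norm_mul, hwn, Complex.norm_real, Real.norm_of_nonneg (by linarith), mul_one]
      have t2 : 1 - r^2 ≤ ‖1 - (r:ℂ)^2 * w‖ := by
        have := norm_sub_norm_le (1:ℂ) ((r:ℂ)^2 * w)
        rw [norm_mul, hwn, norm_pow, Complex.norm_real, Real.norm_of_nonneg h0.le] at this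
        simpa using this
      linarith

theorem hm_a_int (n : ℕ) (hn : n ≠ 0) :
    ∫ θ in (-π)..π, Complex.exp (θ * Complex.I) ^ n * (1 - Complex.exp (θ * Complex.I) ^ 2) ^ (((1/2 : ℝ)) : ℂ) = 0 := by
  have h := hm_mean_pow n (1/2) (fun θ => (2:ℝ) ^ (1/2 : ℝ)) (by simp) ?_
  · rw [h]; simp [hn]
  · intro r h0 h1 θ _
    refine Real.rpow_le_rpow (norm_nonneg _) ?_ (by norm_num)
    refine (norm_sub_le _ _).trans ?_
    rw [norm_one, norm_pow, norm_mul, Complex.norm_exp_ofReal_mul_I, Complex.norm_real, Real.norm_of_nonneg h0.le]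
    have : (r*1)^2 ≤ 1 := pow_le_one₀ (by linarith) (by linarith)
    linarith

theorem hm_norm_mul_cpow (u : ℂ) (hu : u = 0 ∨ 0 < u.re) :
    (‖u‖ : ℂ) * u ^ (-(1/2) : ℂ) = ((starRingEnd ℂ) u) ^ (((1/2 : ℝ)) : ℂ) := by
  rcases hu with rfl | hu
  · simp
  · have hu0 : u ≠ 0 := by rintro rfl; simp at hu
    have harg : u.arg ≠ π := by
      have := (Complex.abs_arg_lt_pi_div_two_iff (z := u)).2 (Or.inl hu)
      have := le_abs_self u.arg
      intro h
      linarith [Real.pi_pos]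
    rw [Complex.conj_cpow _ _ harg, Complex.conj_ofReal, Complex.cpow_neg]
    have e : ((1/2 : ℝ) : ℂ) = 1/2 := by push_cast; rfl
    rw [e]
    set v := u ^ (1/2 : ℂ) with hv
    have hv0 : v ≠ 0 := by
      rw [hv]; simp [Complex.cpow_eq_zero_iff, hu0]
    have hvv : v * v = u := by
      rw [hv, ← Complex.cpow_add _ _ hu0]; norm_num
    have h1 : (‖u‖ : ℂ) = v * (starRingEnd ℂ) v := by
      rw [Complex.mul_conj, Complex.normSq_eq_norm_sq, ← hvv, norm_mul, sq]
    rw [h1]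
    field_simp

theorem hm_sinW (θ : ℝ) : ((|Real.sin θ| : ℝ) : ℂ) * hmW θ =
    1/2 * (1 - Complex.exp (θ * Complex.I) ^ 2) ^ (((1/2 : ℝ)) : ℂ) := by
  have hu := hm_norm_u θ
  have h1 := hm_norm_mul_cpow ((1 : ℂ) - Complex.exp (-2 * Complex.I * (θ : ℂ))) ?_
  · rw [hu] at h1
    have hc : (starRingEnd ℂ) ((1 : ℂ) - Complex.exp (-2 * Complex.I * (θ : ℂ))) =
        1 - Complex.exp (θ * Complex.I) ^ 2 := by
      rw [map_sub, map_one, ← Complex.exp_conj, hm_exp_sq]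
      simp [Complex.conj_ofNat]
    rw [hc] at h1
    rw [← h1, hmW]
    push_cast; ring
  · have e := hm_exp_sq (-θ)
    rw [neg_neg] at e
    rw [← e]
    by_cases hs : Complex.exp ((-θ : ℝ) * Complex.I) ^ 2 = 1
    · left; rw [hs]; simp
    · right; exact hm_slit (Complex.norm_exp_ofReal_mul_I _).le hs

theorem hm_H0_sub (s k : ℤ) (n : ℕ) (hn : k.natAbs = n) : H0 s k = (1 / (2 * (Real.pi : ℂ))) *
    ∫ θ in (-Real.pi)..Real.pi,
      ((hmL θ : ℝ) : ℂ) ^ n * Complex.exp (-Complex.I * (s : ℂ) * (θ : ℂ)) * hmW θ := by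
  rw [← hn]; rfl

theorem hm_four (s : ℤ) (m n : ℕ) (F : ℝ → ℂ) (k1 k2 : ℤ) (h1 : k1.natAbs = m) (h2 : k2.natAbs = n)
    (hF : ∀ θ, F θ = 2 * Real.cos θ * (((hmL θ : ℝ) : ℂ) ^ m + ((hmL θ : ℝ) : ℂ) ^ n) *
      Complex.exp (-Complex.I * (s : ℂ) * (θ : ℂ)) * hmW θ)  :
    H0 (s + 1) k1 + H0 (s + 1) k2 + H0 (s - 1) k1 + H0 (s - 1) k2 = (1 / (2 * (Real.pi : ℂ))) *
    ∫ θ in (-Real.pi)..Real.pi, F θ := by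
  rw [hm_H0_sub _ k1 m h1, hm_H0_sub _ k2 n h2, hm_H0_sub _ k1 m h1, hm_H0_sub _ k2 n h2,
    ← mul_add, ← mul_add, ← mul_add]
  congr 1
  have i1 := hm_int (s+1) m
  have i2 := hm_int (s+1) n
  have i3 := hm_int (s-1) m
  have i4 := hm_int (s-1) n
  rw [← intervalIntegral.integral_add i1 i2, ← intervalIntegral.integral_add (i1.add i2) i3,
    ← intervalIntegral.integral_add ((i1.add i2).add i3) i4]
  congr 1; ext θ
  rw [hF]
  have e1 : Complex.exp (-Complex.I * ((s + 1 : ℤ) : ℂ) * (θ : ℂ)) =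
      Complex.exp (-Complex.I * (s : ℂ) * (θ : ℂ)) * Complex.exp (-θ * Complex.I) := by
    rw [← Complex.exp_add]; congr 1; push_cast; ring
  have e2 : Complex.exp (-Complex.I * ((s - 1 : ℤ) : ℂ) * (θ : ℂ)) =
      Complex.exp (-Complex.I * (s : ℂ) * (θ : ℂ)) * Complex.exp (θ * Complex.I) := by
    rw [← Complex.exp_add]; congr 1; push_cast; ring
  rw [e1, e2, Complex.ofReal_cos, Complex.two_cos]
  ring

theorem hm_a (s k : ℤ) (h : k ≠ 0 ∨ s ≤ -1) :
    H0 (s + 1) (k + 1) + H0 (s + 1) (k - 1) + H0 (s - 1) (k + 1) + H0 (s - 1) (k - 1) = 4 * H0 s k := by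
  by_cases hk : k = 0
  · subst hk
    have hs : s ≤ -1 := by simpa using h
    have hH := hm_four s 1 1 _ (0+1) (0-1) rfl rfl (fun θ => rfl)
    rw [hH, hm_H0_sub s 0 0 rfl]
    have i0 := (hm_int s 0).const_mul 4
    have key : ∀ θ : ℝ, 2 * (Real.cos θ : ℂ) * (((hmL θ : ℝ) : ℂ) ^ 1 + ((hmL θ : ℝ) : ℂ) ^ 1) *
      Complex.exp (-Complex.I * (s : ℂ) * (θ : ℂ)) * hmW θ =
      4 * (((hmL θ : ℝ) : ℂ) ^ 0 * Complex.exp (-Complex.I * (s : ℂ) * (θ : ℂ)) * hmW θ) -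
      2 * (Complex.exp (θ * Complex.I) ^ s.natAbs * (1 - Complex.exp (θ * Complex.I) ^ 2) ^ (((1/2 : ℝ)) : ℂ)) := by
      intro θ
      have e1 : Complex.exp (θ * Complex.I) ^ s.natAbs = Complex.exp (-Complex.I * (s : ℂ) * (θ : ℂ)) := by
        rw [← Complex.exp_nat_mul]; congr 1
        have : (s : ℂ) = -(s.natAbs : ℂ) := by
          have : s = -(s.natAbs : ℤ) := by omega
          exact_mod_cast this
        rw [this]; ring
      rw [e1]
      have e2 := hm_sinW θ
      have e3 : (Real.cos θ : ℂ) * (hmL θ : ℂ) = 1 - ((|Real.sin θ| : ℝ) : ℂ) := by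
        exact_mod_cast hm_L_id2 θ
      linear_combination 4 * Complex.exp (-Complex.I * (s : ℂ) * (θ : ℂ)) * hmW θ * e3 -
        4 * Complex.exp (-Complex.I * (s : ℂ) * (θ : ℂ)) * e2
    simp only [key]
    rw [intervalIntegral.integral_sub i0, intervalIntegral.integral_const_mul,
      intervalIntegral.integral_const_mul, hm_a_int _ (by omega)]
    · ring
    · refine Continuous.intervalIntegrable ?_ _ _
      refine continuous_const.mul (Continuous.mul (by fun_prop) ?_)
      have hcc : Continuous (fun θ : ℝ => 1 - Complex.exp (θ * Complex.I) ^ 2) := by fun_prop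
      refine continuous_iff_continuousAt.2 fun θ => ?_
      by_cases hz : Complex.exp (θ * Complex.I) ^ 2 = 1
      · have hz' : (1 - Complex.exp (θ * Complex.I) ^ 2) = 0 := by rw [hz, sub_self]
        have := Complex.continuousAt_cpow_const_of_re_pos (z := 1 - Complex.exp (θ * Complex.I) ^ 2)
          (w := ((1/2:ℝ):ℂ)) (Or.inl (by rw [hz']; simp)) (by rw [Complex.ofReal_re]; norm_num)
        exact this.comp (f := fun θ : ℝ => 1 - Complex.exp (θ * Complex.I) ^ 2) hcc.continuousAt
      · exact hcc.continuousAt.cpow continuousAt_const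
          (Or.inl (hm_slit (Complex.norm_exp_ofReal_mul_I _).le hz))
  · obtain ⟨n, hn⟩ : ∃ n : ℕ, k.natAbs = n + 1 := ⟨k.natAbs - 1, by omega⟩
    have gen : ∀ k1 k2 : ℤ, k1.natAbs = n + 2 → k2.natAbs = n →
        H0 (s + 1) k1 + H0 (s + 1) k2 + H0 (s - 1) k1 + H0 (s - 1) k2 = 4 * H0 s k := by
      intro k1 k2 h1 h2
      rw [hm_four s (n+2) n (fun θ => 4 * (((hmL θ : ℝ) : ℂ) ^ (n+1) * Complex.exp (-Complex.I * (s : ℂ) * (θ : ℂ)) * hmW θ))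
        k1 k2 h1 h2, intervalIntegral.integral_const_mul, hm_H0_sub s k (n+1) hn]
      · ring
      · intro θ
        have e3 : (Real.cos θ : ℂ) * ((hmL θ : ℂ) ^ 2 + 1) = 2 * (hmL θ : ℂ) := by
          exact_mod_cast hm_L_id θ
        linear_combination (-2) * (hmL θ : ℂ)^n * Complex.exp (-Complex.I * (s : ℂ) * (θ : ℂ)) * hmW θ * e3
    rcases lt_or_gt_of_ne hk with hk' | hk'
    · rw [← gen (k - 1) (k + 1) (by omega) (by omega)]; ring
    · exact gen (k + 1) (k - 1) (by omega) (by omega)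


theorem H0_unique_solution_slit_dirichlet :
    (∀ s k : ℤ, (k ≠ 0 ∨ s ≤ -1) →
      H0 (s + 1) (k + 1) + H0 (s + 1) (k - 1) + H0 (s - 1) (k + 1) + H0 (s - 1) (k - 1)
        = 4 * H0 s k) ∧
    (H0 0 0 = 1 ∧ ∀ s : ℤ, 1 ≤ s → H0 s 0 = 0) ∧
    (∀ ε : ℝ, 0 < ε → ∃ R : ℕ, ∀ s k : ℤ, (R : ℤ) ≤ |s| + |k| → ‖H0 s k‖ ≤ ε) ∧
    (∀ L : ℤ × ℤ → ℂ,
      (∀ s k : ℤ, (k ≠ 0 ∨ s ≤ -1) →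
        L (s + 1, k + 1) + L (s + 1, k - 1) + L (s - 1, k + 1) + L (s - 1, k - 1)
          = 4 * L (s, k)) →
      (L (0, 0) = 1 ∧ ∀ s : ℤ, 1 ≤ s → L (s, 0) = 0) →
      (∀ ε : ℝ, 0 < ε → ∃ R : ℕ, ∀ s k : ℤ, (R : ℤ) ≤ |s| + |k| → ‖L (s, k)‖ ≤ ε) →
      L = fun p => H0 p.1 p.2) := by

  have hb0 : H0 0 0 = 1 := by simpa using hm_b 0
  have hb1 : ∀ s : ℤ, 1 ≤ s → H0 s 0 = 0 := by
    intro s hs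
    have h := hm_b s.toNat
    rw [Int.toNat_of_nonneg (by omega)] at h
    rw [h, zero_pow (by omega)]
  refine ⟨hm_a, ⟨hb0, hb1⟩, hm_c, ?_⟩
  intro L ha hb hc
  have hD := hm_uniq (fun p => L p - H0 p.1 p.2) ?_ ?_ ?_
  · funext p
    exact sub_eq_zero.1 (hD p)
  · intro s k hsk
    have h1 := ha s k hsk
    have h2 := hm_a s k hsk
    dsimp only
    linear_combination h1 - h2
  · intro s hs
    rcases hs.eq_or_lt with rfl | hs
    · simp [hb.1, hb0]
    · simp [hb.2 s (by omega), hb1 s (by omega)]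
  · intro ε hε
    obtain ⟨R1, h1⟩ := hc (ε/2) (by positivity)
    obtain ⟨R2, h2⟩ := hm_c (ε/2) (by positivity)
    refine ⟨R1 + R2, fun s k hsk => ?_⟩
    push_cast at hsk
    have := h1 s k (by omega)
    have := h2 s k (by omega)
    refine (norm_sub_le _ _).trans ?_
    dsimp only
    linarith
end

section
/- For every integer s that is odd, or that is positive, one has H₀(s,0) = 0; that is, ∫_{−π}^{π} exp(−i·s·θ) · (1 − exp(−2iθ))^(−1/2) dθ = 0 whenever the integer s is odd or s ≥ 1. -/
theorem aux_int : ∀ a b : ℝ, IntervalIntegrable (fun x : ℝ => |Real.sin x| ^ (-(1/2) : ℝ))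
    MeasureTheory.volume a b := by
  have hper : Function.Periodic (fun x : ℝ => |Real.sin x| ^ (-(1/2) : ℝ)) Real.pi := by
    intro x
    simp [Real.sin_add_pi]
  have hpi := Real.pi_pos
  have hmeas : Measurable (fun x : ℝ => |Real.sin x| ^ (-(1/2) : ℝ)) := by
    fun_prop
  have h0 : IntervalIntegrable (fun x : ℝ => |Real.sin x| ^ (-(1/2) : ℝ))
      MeasureTheory.volume 0 (Real.pi/2) := by
    have h1 : IntervalIntegrable (fun x : ℝ => (2/Real.pi) ^ (-(1/2) : ℝ) * x ^ (-(1/2) : ℝ))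
      MeasureTheory.volume 0 (Real.pi/2) :=
      (intervalIntegral.intervalIntegrable_rpow' (by norm_num)).const_mul _
    refine h1.mono_fun hmeas.aestronglyMeasurable ?_
    refine (MeasureTheory.ae_restrict_iff' measurableSet_uIoc).2 (Filter.Eventually.of_forall ?_)
    intro x hx
    rw [Set.uIoc_of_le (by positivity)] at hx
    have hx0 : 0 < x := hx.1
    have h2 := Real.mul_le_sin hx0.le hx.2
    show ‖|Real.sin x| ^ (-(1/2) : ℝ)‖ ≤ ‖(2/Real.pi) ^ (-(1/2) : ℝ) * x ^ (-(1/2) : ℝ)‖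
    rw [← Real.mul_rpow (by positivity) hx0.le]
    have h3 : 0 < 2 / Real.pi * x := by positivity
    rw [Real.norm_of_nonneg (by positivity), Real.norm_of_nonneg (by positivity)]
    apply Real.rpow_le_rpow_of_nonpos h3 _ (by norm_num)
    exact h2.trans (le_abs_self _)
  have h1 : IntervalIntegrable (fun x : ℝ => |Real.sin x| ^ (-(1/2) : ℝ))
      MeasureTheory.volume (-(Real.pi/2)) 0 := by
    have := (IntervalIntegrable.iff_comp_neg (by simp)).1 h0
    simpa using this.symm
  intro a b
  refine hper.intervalIntegrable hpi.ne' (t := -(Real.pi/2)) ?_ a b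
  have := h1.trans h0
  convert this using 1
  ring

theorem aux_re (r : ℝ) (h0 : 0 ≤ r) (h1 : r < 1) (w : ℂ) (hw : ‖w‖ ≤ 1) :
    (1 - (r : ℂ) * w ^ 2) ∈ Complex.slitPlane := by
  left
  have h2 : ((r : ℂ) * w ^ 2).re ≤ ‖(r : ℂ) * w ^ 2‖ := Complex.re_le_norm _
  have h3 : ‖(r : ℂ) * w ^ 2‖ ≤ r := by
    rw [norm_mul, norm_pow, Complex.norm_real, Real.norm_of_nonneg h0]
    have : ‖w‖ ^ 2 ≤ 1 := pow_le_one₀ (norm_nonneg _) hw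
    nlinarith
  simp only [Complex.sub_re, Complex.one_re]
  linarith

theorem aux_zero (n : ℕ) (hn : n ≠ 0) (r : ℝ) (h0 : 0 ≤ r) (h1 : r < 1) :
    (∫ θ in (-Real.pi)..Real.pi, Complex.exp (-Complex.I * (θ : ℂ)) ^ n *
      (1 - (r : ℂ) * Complex.exp (-Complex.I * (θ : ℂ)) ^ 2) ^ (-(1 / 2) : ℂ)) = 0 := by
  set g : ℂ → ℂ := fun w => w ^ n * (1 - (r : ℂ) * w ^ 2) ^ (-(1 / 2) : ℂ) with hg
  have hd : ∀ w ∈ Metric.closedBall (0 : ℂ) |1|, DifferentiableAt ℂ g w := by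
    intro w hw
    have : ‖w‖ ≤ 1 := by simpa using hw
    refine (differentiableAt_id.pow n).mul ?_
    exact DifferentiableAt.cpow (by fun_prop) (by fun_prop) (aux_re r h0 h1 w this)
  have hav : Real.circleAverage g 0 1 = g 0 :=
    circleAverage_of_differentiable_on_off_countable Set.countable_empty
      (fun w hw => (hd w hw).continuousAt.continuousWithinAt)
      (fun w hw => hd w (Metric.ball_subset_closedBall hw.1))
  have hg0 : g 0 = 0 := by simp [hg, hn]
  rw [hg0, Real.circleAverage_def] at hav
  have hpi := Real.pi_pos
  have hav2 : (∫ θ in (0)..2 * Real.pi, g (circleMap 0 1 θ)) = 0 := by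
    rcases smul_eq_zero.1 hav with h | h
    · exact absurd h (by positivity)
    · exact h
  have hper : Function.Periodic (fun θ => g (circleMap 0 1 θ)) (2 * Real.pi) := by
    intro θ
    simp only [periodic_circleMap 0 1 θ]
  have h3 := hper.intervalIntegral_add_eq (-Real.pi) 0
  have h4 : -Real.pi + 2 * Real.pi = Real.pi := by ring
  rw [h4, zero_add, hav2] at h3
  have h5 := intervalIntegral.integral_comp_neg (a := -Real.pi) (b := Real.pi)
    (fun θ => g (circleMap 0 1 θ))
  rw [neg_neg, h3] at h5
  rw [← h5]
  congr 1
  ext θ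
  have : circleMap 0 1 (-θ) = Complex.exp (-Complex.I * (θ : ℂ)) := by
    simp [circleMap, mul_comm]
  rw [this]

theorem aux_norm (θ : ℝ) : ‖1 - Complex.exp (-Complex.I * (θ : ℂ)) ^ 2‖ = 2 * |Real.sin θ| := by
  have e : -Complex.I * (θ : ℂ) = ((-θ : ℝ) : ℂ) * Complex.I := by push_cast; ring
  have h1 : 1 - Complex.exp (-Complex.I * (θ : ℂ)) ^ 2 =
      Complex.exp (-Complex.I * (θ : ℂ)) * (2 * Complex.I * (Real.sin θ : ℂ)) := by
    rw [e, Complex.exp_mul_I]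
    push_cast
    rw [Complex.cos_neg, Complex.sin_neg]
    have := Complex.sin_sq_add_cos_sq (θ : ℂ)
    linear_combination (-1 : ℂ) * this - (Complex.sin θ)^2 * Complex.I_sq + 2 * (Complex.sin θ)^2 * Complex.I_sq
  rw [h1, e, norm_mul, Complex.norm_exp_ofReal_mul_I, norm_mul, Complex.norm_real]
  simp

theorem aux_lim (n : ℕ) (hn : n ≠ 0) :
    (∫ θ in (-Real.pi)..Real.pi, Complex.exp (-Complex.I * (θ : ℂ)) ^ n *
      (1 - Complex.exp (-Complex.I * (θ : ℂ)) ^ 2) ^ (-(1 / 2) : ℂ)) = 0 := by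
  have hae : ∀ᵐ θ : ℝ, Real.sin θ ≠ 0 := by
    have hc : (Set.range fun n : ℤ => (n : ℝ) * Real.pi).Countable := Set.countable_range _
    have := hc.ae_notMem MeasureTheory.volume
    filter_upwards [this] with θ hθ h
    exact hθ (Real.sin_eq_zero_iff.1 h)
  have hn1 : ∀ θ : ℝ, ‖Complex.exp (-Complex.I * (θ : ℂ))‖ = 1 := by
    intro θ
    simp [Complex.norm_exp]
  have hev : ∀ᶠ r : ℝ in nhdsWithin 1 (Set.Iio 1), 0 ≤ r ∧ r < 1 := by
    have h1 : ∀ᶠ r : ℝ in nhdsWithin 1 (Set.Iio 1), 0 ≤ r :=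
      nhdsWithin_le_nhds (Filter.eventually_of_mem (Ici_mem_nhds zero_lt_one) (fun _ h => h))
    filter_upwards [h1, self_mem_nhdsWithin] with r h2 h3 using ⟨h2, h3⟩
  have key := intervalIntegral.tendsto_integral_filter_of_dominated_convergence
    (μ := MeasureTheory.volume) (a := -Real.pi) (b := Real.pi)
    (l := nhdsWithin (1 : ℝ) (Set.Iio 1))
    (F := fun (r : ℝ) (θ : ℝ) => Complex.exp (-Complex.I * (θ : ℂ)) ^ n *
      (1 - (r : ℂ) * Complex.exp (-Complex.I * (θ : ℂ)) ^ 2) ^ (-(1 / 2) : ℂ))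
    (f := fun (θ : ℝ) => Complex.exp (-Complex.I * (θ : ℂ)) ^ n *
      (1 - Complex.exp (-Complex.I * (θ : ℂ)) ^ 2) ^ (-(1 / 2) : ℂ))
    (fun x : ℝ => |Real.sin x| ^ (-(1/2) : ℝ)) ?_ ?_ (aux_int _ _) ?_
  · refine tendsto_nhds_unique key ?_
    refine tendsto_const_nhds.congr' ?_
    filter_upwards [hev] with r hr
    exact (aux_zero n hn r hr.1 hr.2).symm
  · refine Filter.Eventually.of_forall fun r => ?_
    apply Measurable.aestronglyMeasurable
    fun_prop
  · filter_upwards [hev] with r hr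
    filter_upwards [hae] with θ hθ _
    rw [norm_mul, norm_pow, hn1, one_pow, one_mul]
    have e : (-(1/2) : ℂ) = ((-(1/2) : ℝ) : ℂ) := by push_cast; rfl
    rw [e, Complex.norm_cpow_real]
    apply Real.rpow_le_rpow_of_nonpos (abs_pos.2 hθ) _ (by norm_num)
    set u := Complex.exp (-Complex.I * (θ : ℂ)) ^ 2 with hu
    have hun : ‖u‖ = 1 := by rw [hu, norm_pow, hn1, one_pow]
    have h1 : ‖1 - u‖ = 2 * |Real.sin θ| := aux_norm θ
    have h2 : ‖1 - u‖ ≤ ‖1 - (r : ℂ) * u‖ + ‖((r - 1 : ℝ) : ℂ) * u‖ := by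
      have := norm_add_le (1 - (r : ℂ) * u) (((r - 1 : ℝ) : ℂ) * u)
      have e3 : 1 - (r : ℂ) * u + ((r - 1 : ℝ) : ℂ) * u = 1 - u := by push_cast; ring
      rwa [e3] at this
    have h3 : ‖((r - 1 : ℝ) : ℂ) * u‖ = 1 - r := by
      rw [norm_mul, hun, Complex.norm_real, mul_one, Real.norm_eq_abs, abs_of_nonpos (by linarith)]
      ring
    have h4 : 1 - r ≤ ‖1 - (r : ℂ) * u‖ := by
      have := norm_sub_norm_le (1 : ℂ) ((r : ℂ) * u)
      rw [norm_mul, hun, Complex.norm_real, mul_one, Real.norm_of_nonneg hr.1, norm_one] at this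
      exact this
    linarith
  · filter_upwards [hae] with θ hθ _
    have hs : (1 - ((1 : ℝ) : ℂ) * Complex.exp (-Complex.I * (θ : ℂ)) ^ 2) ∈ Complex.slitPlane := by
      left
      have e : Complex.exp (-Complex.I * (θ : ℂ)) ^ 2 = Complex.exp (((-(2*θ) : ℝ) : ℂ) * Complex.I) := by
        rw [← Complex.exp_nat_mul]; congr 1; push_cast; ring
      rw [e, Complex.ofReal_one, one_mul, Complex.sub_re, Complex.exp_ofReal_mul_I_re, Real.cos_neg,
        Real.cos_two_mul, Complex.one_re]
      have := Real.sin_sq_add_cos_sq θ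
      have : 0 < Real.sin θ ^ 2 := by positivity
      nlinarith
    have hc : ContinuousAt (fun r : ℝ => Complex.exp (-Complex.I * (θ : ℂ)) ^ n *
      (1 - (r : ℂ) * Complex.exp (-Complex.I * (θ : ℂ)) ^ 2) ^ (-(1 / 2) : ℂ)) 1 := by
      refine continuousAt_const.mul ?_
      exact ContinuousAt.cpow (by fun_prop) continuousAt_const hs
    have := hc.tendsto.mono_left (nhdsWithin_le_nhds (s := Set.Iio 1))
    simpa using this

theorem aux_main (s : ℤ) (hs : Odd s ∨ 1 ≤ s) :
      (∫ θ in (-Real.pi)..Real.pi,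
        Complex.exp (-Complex.I * (s : ℂ) * (θ : ℂ)) *
          ((1 : ℂ) - Complex.exp (-2 * Complex.I * (θ : ℂ))) ^ (-(1 / 2) : ℂ)) = 0 := by
  rcases hs with hs | hs
  · set f : ℝ → ℂ := fun θ => Complex.exp (-Complex.I * (s : ℂ) * (θ : ℂ)) *
          ((1 : ℂ) - Complex.exp (-2 * Complex.I * (θ : ℂ))) ^ (-(1 / 2) : ℂ) with hf
    have hanti : ∀ θ, f (θ + Real.pi) = - f θ := by
      intro θ
      obtain ⟨m, rfl⟩ := hs
      simp only [hf]
      have e1 : Complex.exp (-Complex.I * ((2 * m + 1 : ℤ) : ℂ) * ((θ + Real.pi : ℝ) : ℂ)) =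
          - Complex.exp (-Complex.I * ((2 * m + 1 : ℤ) : ℂ) * (θ : ℂ)) := by
        have : -Complex.I * ((2 * m + 1 : ℤ) : ℂ) * ((θ + Real.pi : ℝ) : ℂ) =
          -Complex.I * ((2 * m + 1 : ℤ) : ℂ) * (θ : ℂ) + Real.pi * Complex.I
            + ((-m-1 : ℤ) : ℂ) * (2 * Real.pi * Complex.I) := by push_cast; ring
        rw [this, Complex.exp_add, Complex.exp_int_mul_two_pi_mul_I, Complex.exp_add,
          Complex.exp_pi_mul_I]
        ring
      have e2 : Complex.exp (-2 * Complex.I * ((θ + Real.pi : ℝ) : ℂ)) =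
          Complex.exp (-2 * Complex.I * (θ : ℂ)) := by
        have : -2 * Complex.I * ((θ + Real.pi : ℝ) : ℂ) =
          -2 * Complex.I * (θ : ℂ) + ((-1 : ℤ) : ℂ) * (2 * Real.pi * Complex.I) := by
            push_cast; ring
        rw [this, Complex.exp_add, Complex.exp_int_mul_two_pi_mul_I, mul_one]
      rw [e1, e2, neg_mul]
    have hper : Function.Periodic f (2 * Real.pi) := by
      intro θ
      rw [two_mul, ← add_assoc, hanti, hanti, neg_neg]
    have h1 := hper.intervalIntegral_add_eq (-Real.pi) 0
    have h2 := intervalIntegral.integral_comp_add_right (a := -Real.pi) (b := Real.pi) f Real.pi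
    have h4 : -Real.pi + 2 * Real.pi = Real.pi := by ring
    rw [h4, zero_add] at h1
    rw [neg_add_cancel, ← two_mul, ← h1] at h2
    simp only [hanti, intervalIntegral.integral_neg] at h2
    exact self_eq_neg.1 h2.symm
  · obtain ⟨n, rfl⟩ := Int.eq_ofNat_of_zero_le (by omega : 0 ≤ s)
    rw [← aux_lim n (by omega)]
    congr 1
    ext θ
    rw [← Complex.exp_nat_mul, ← Complex.exp_nat_mul]
    have e1 : -Complex.I * (((n : ℤ) : ℤ) : ℂ) * (θ : ℂ) = (n : ℂ) * (-Complex.I * (θ : ℂ)) := by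
      push_cast; ring
    have e2 : -2 * Complex.I * (θ : ℂ) = ((2 : ℕ) : ℂ) * (-Complex.I * (θ : ℂ)) := by
      push_cast; ring
    rw [e2, ← e1]

theorem H0_vanishes_on_slit (s : ℤ) (hs : Odd s ∨ 1 ≤ s) :
    H0 s 0 = 0 ∧
      (∫ θ in (-Real.pi)..Real.pi,
        Complex.exp (-Complex.I * (s : ℂ) * (θ : ℂ)) *
          ((1 : ℂ) - Complex.exp (-2 * Complex.I * (θ : ℂ))) ^ (-(1 / 2) : ℂ)) = 0 := by
  refine ⟨?_, aux_main s hs⟩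
  unfold H0
  simp only [Int.natAbs_zero, pow_zero, one_mul]
  rw [aux_main s hs, mul_zero]
end

section
/- For every natural number n, H₀(−2n, 0) = (Nat.centralBinom n)/4^n; that is, (1/(2π)) · ∫_{−π}^{π} exp(2·i·n·θ) · (1 − exp(−2iθ))^(−1/2) dθ equals the central binomial coefficient (2n choose n) divided by 4^n. -/
open MeasureTheory Filter Topology

lemma choose_half (n : ℕ) :
    Ring.choose ((1 / 2 : ℂ) + n - 1) n = (Nat.centralBinom n : ℂ) / 4 ^ n := by
  rw [← Ring.multichoose_eq]
  have h := Ring.factorial_nsmul_multichoose_eq_ascPochhammer (1 / 2 : ℂ) n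
  rw [Polynomial.ascPochhammer_smeval_eq_eval, nsmul_eq_mul] at h
  have hf : (n.factorial : ℂ) ≠ 0 := by exact_mod_cast n.factorial_ne_zero
  apply mul_left_cancel₀ hf
  rw [h]
  clear h hf
  induction n with
  | zero => simp
  | succ n ih =>
    rw [ascPochhammer_succ_eval, ih, Nat.factorial_succ]
    have := Nat.succ_mul_centralBinom_succ n
    have h2 : ((n : ℂ) + 1) * (Nat.centralBinom (n + 1) : ℂ)
        = 2 * (2 * n + 1) * Nat.centralBinom n := by exact_mod_cast this
    push_cast
    rw [show ((n : ℂ) + 1) * (n.factorial : ℂ) * ((Nat.centralBinom (n + 1) : ℂ) / 4 ^ (n + 1))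
      = n.factorial * (((n : ℂ) + 1) * (Nat.centralBinom (n + 1) : ℂ)) / 4 ^ (n + 1) by ring, h2]
    rw [pow_succ]
    field_simp
    ring

lemma hasSum_aux {z : ℂ} (hz : ‖z‖ < 1) :
    HasSum (fun k : ℕ => (Nat.centralBinom k : ℂ) / 4 ^ k * z ^ k)
      ((1 - z) ^ (-(1 / 2) : ℂ)) := by
  have h := (Complex.one_div_one_sub_cpow_hasFPowerSeriesOnBall_zero (1 / 2)).hasSum
    (y := z) (by rw [Metric.mem_eball, edist_zero_right, ← ofReal_norm, ENNReal.ofReal_lt_one]; exact hz)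
  simp only [choose_half] at h
  rw [Complex.cpow_neg]
  simpa [FormalMultilinearSeries.ofScalars_apply_eq, mul_comm] using h

lemma integral_exp_aux (m : ℤ) :
    ∫ θ in (-Real.pi)..Real.pi, Complex.exp (2 * Complex.I * m * (θ : ℂ))
      = if m = 0 then 2 * (Real.pi : ℂ) else 0 := by
  split_ifs with h
  · subst h
    simp
    ring
  · rw [integral_exp_mul_complex (by simp [h])]
    have : Complex.exp (2 * Complex.I * m * (Real.pi : ℂ))
        = Complex.exp (2 * Complex.I * m * ((-Real.pi : ℝ) : ℂ)) := by
      rw [Complex.exp_eq_exp_iff_exists_int]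
      exact ⟨2 * m, by push_cast; ring⟩
    rw [this]
    simp

lemma norm_e (θ : ℝ) : ‖Complex.exp (-2 * Complex.I * (θ : ℂ))‖ = 1 := by
  rw [Complex.norm_exp]; simp

lemma coeff_le (k : ℕ) : ‖(Nat.centralBinom k : ℂ) / 4 ^ k‖ ≤ 1 := by
  rw [norm_div, norm_pow, Complex.norm_natCast]
  simp only [Complex.norm_ofNat]
  rw [div_le_one (by positivity)]
  exact_mod_cast Nat.centralBinom_le_four_pow k

lemma integral_r (n : ℕ) {r : ℝ} (h0 : 0 ≤ r) (h1 : r < 1) :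
    ∫ θ in (-Real.pi)..Real.pi, Complex.exp (2 * Complex.I * n * (θ : ℂ)) *
      (1 - r * Complex.exp (-2 * Complex.I * (θ : ℂ))) ^ (-(1 / 2) : ℂ)
      = 2 * (Real.pi : ℂ) * ((Nat.centralBinom n : ℂ) / 4 ^ n * r ^ n) := by
  have key : HasSum (fun k : ℕ => ∫ θ in (-Real.pi)..Real.pi,
      Complex.exp (2 * Complex.I * n * (θ : ℂ)) * ((Nat.centralBinom k : ℂ) / 4 ^ k *
        (r * Complex.exp (-2 * Complex.I * (θ : ℂ))) ^ k))
      (∫ θ in (-Real.pi)..Real.pi, Complex.exp (2 * Complex.I * n * (θ : ℂ)) *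
      (1 - r * Complex.exp (-2 * Complex.I * (θ : ℂ))) ^ (-(1 / 2) : ℂ)) := by
    apply intervalIntegral.hasSum_integral_of_dominated_convergence (fun k _ => r ^ k)
    · intro k
      apply Continuous.aestronglyMeasurable
      fun_prop
    · intro k
      refine Eventually.of_forall fun θ _ => ?_
      rw [norm_mul, norm_mul, norm_pow, norm_mul, norm_e, Complex.norm_exp]
      have := coeff_le k
      simp only [Complex.norm_real, Real.norm_eq_abs, abs_of_nonneg h0]
      simp only [mul_one]
      have h3 : (2 * Complex.I * n * (θ : ℂ)).re = 0 := by simp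
      rw [h3, Real.exp_zero, one_mul]
      exact mul_le_of_le_one_left (by positivity) this
    · exact Eventually.of_forall fun θ _ => summable_geometric_of_lt_one h0 h1
    · exact intervalIntegrable_const
    · refine Eventually.of_forall fun θ _ => ?_
      apply HasSum.mul_left
      apply hasSum_aux
      rw [norm_mul, norm_e]
      simpa [abs_of_nonneg h0] using h1
  have h2 : ∀ k : ℕ, ∫ θ in (-Real.pi)..Real.pi,
      Complex.exp (2 * Complex.I * n * (θ : ℂ)) * ((Nat.centralBinom k : ℂ) / 4 ^ k *
        (r * Complex.exp (-2 * Complex.I * (θ : ℂ))) ^ k)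
      = if k = n then 2 * (Real.pi : ℂ) * ((Nat.centralBinom n : ℂ) / 4 ^ n * r ^ n) else 0 := by
    intro k
    have : ∀ θ : ℝ, Complex.exp (2 * Complex.I * n * (θ : ℂ)) * ((Nat.centralBinom k : ℂ) / 4 ^ k *
        (r * Complex.exp (-2 * Complex.I * (θ : ℂ))) ^ k)
        = ((Nat.centralBinom k : ℂ) / 4 ^ k * r ^ k) *
          Complex.exp (2 * Complex.I * ((n - k : ℤ) : ℂ) * (θ : ℂ)) := by
      intro θ
      rw [mul_pow, ← Complex.exp_nat_mul]
      rw [show 2 * Complex.I * ((n - k : ℤ) : ℂ) * (θ : ℂ) = 2 * Complex.I * n * (θ : ℂ) +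
        k * (-2 * Complex.I * (θ : ℂ)) by push_cast; ring, Complex.exp_add]
      ring
    simp_rw [this]
    rw [intervalIntegral.integral_const_mul, integral_exp_aux]
    by_cases h : k = n
    · subst h; simp; ring
    · rw [if_neg h, if_neg (by omega)]; simp
  simp_rw [h2] at key
  exact key.unique (hasSum_ite_eq n _)

lemma norm_ge (θ : ℝ) {r : ℝ} (h0 : 0 ≤ r) (h1 : r ≤ 1) :
    |Real.sin θ| ≤ ‖1 - r * Complex.exp (-2 * Complex.I * (θ : ℂ))‖ := by
  set e := Complex.exp (-2 * Complex.I * (θ : ℂ)) with he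
  have hne : ‖e‖ = 1 := norm_e θ
  have h2 : ‖1 - e‖ = 2 * |Real.sin θ| := by
    have : 1 - e = 2 * Complex.I * Complex.exp (-Complex.I * θ) * Complex.sin θ := by
      rw [Complex.sin, he, show -2 * Complex.I * (θ : ℂ) = -Complex.I * θ + -Complex.I * θ by ring,
        Complex.exp_add]
      have : Complex.exp (-Complex.I * θ) * Complex.exp (θ * Complex.I) = 1 := by
        rw [← Complex.exp_add]; ring_nf; simp
      rw [show -(θ : ℂ) * Complex.I = -Complex.I * θ by ring]
      linear_combination (-1 : ℂ) * this + (Complex.exp (-Complex.I * θ) ^ 2 - 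
        Complex.exp (-Complex.I * θ) * Complex.exp (θ * Complex.I)) * (-Complex.I_sq)
    rw [this, ← Complex.ofReal_sin, norm_mul, norm_mul, Complex.norm_exp, Complex.norm_real]
    simp
  have h3 : 1 - r ≤ ‖1 - r * e‖ := by
    have := norm_sub_norm_le (1 : ℂ) (r * e)
    rw [norm_mul, hne] at this
    simpa [abs_of_nonneg h0] using this
  have h4 : ‖1 - e‖ ≤ ‖1 - r * e‖ + (1 - r) := by
    have h5 : ‖((r - 1 : ℝ) : ℂ) * e‖ = 1 - r := by
      rw [norm_mul, hne, Complex.norm_real, Real.norm_eq_abs, abs_of_nonpos (by linarith)]; ring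
    rw [← h5]
    refine le_trans (le_of_eq ?_) (norm_add_le _ _)
    congr 1
    push_cast
    ring
  linarith

lemma sin_rpow_le {t : ℝ} (h : |t| ≤ Real.pi / 2) (ht : t ≠ 0) :
    0 < |Real.sin t| ∧ |Real.sin t| ^ (-(1 / 2) : ℝ) ≤
      (2 / Real.pi) ^ (-(1 / 2) : ℝ) * ‖(t : ℂ) ^ (-(1 / 2) : ℂ)‖ := by
  have hp := Real.pi_pos
  have h1 := Real.mul_abs_le_abs_sin h
  have h2 : 0 < |t| := abs_pos.2 ht
  have h3 : 0 < 2 / Real.pi * |t| := by positivity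
  refine ⟨h3.trans_le h1, ?_⟩
  have : ‖(t : ℂ) ^ (-(1 / 2) : ℂ)‖ = |t| ^ (-(1 / 2) : ℝ) := by
    have := Complex.norm_cpow_real t (-(1 / 2))
    simpa using this
  rw [this, ← Real.mul_rpow (by positivity) (by positivity)]
  exact Real.rpow_le_rpow_of_nonpos h3 h1 (by norm_num)

noncomputable def bnd (θ : ℝ) : ℝ := (2 / Real.pi) ^ (-(1 / 2) : ℝ) *
  (‖(θ : ℂ) ^ (-(1 / 2) : ℂ)‖ + ‖((θ - Real.pi : ℝ) : ℂ) ^ (-(1 / 2) : ℂ)‖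
    + ‖((θ + Real.pi : ℝ) : ℂ) ^ (-(1 / 2) : ℂ)‖)

lemma bnd_int (a b : ℝ) : IntervalIntegrable bnd volume a b := by
  have h : ∀ a b, IntervalIntegrable (fun θ : ℝ => ‖(θ : ℂ) ^ (-(1 / 2) : ℂ)‖) volume a b :=
    fun a b => (intervalIntegral.intervalIntegrable_cpow' (by norm_num)).norm
  unfold bnd
  apply IntervalIntegrable.const_mul
  refine ((h a b).add ?_).add ?_
  · have := (h (a - Real.pi) (b - Real.pi)).comp_sub_right Real.pi
    simpa using this
  · have := (h (a + Real.pi) (b + Real.pi)).comp_add_right Real.pi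
    simpa using this

lemma sin_bnd {θ : ℝ} (hl : -Real.pi < θ) (hr : θ < Real.pi) (h0 : θ ≠ 0) :
    0 < |Real.sin θ| ∧ |Real.sin θ| ^ (-(1 / 2) : ℝ) ≤ bnd θ := by
  have hK : 0 ≤ (2 / Real.pi) ^ (-(1 / 2) : ℝ) := by have := Real.pi_pos; positivity
  have g1 := mul_nonneg hK (norm_nonneg ((θ : ℂ) ^ (-(1 / 2) : ℂ)))
  have g2 := mul_nonneg hK (norm_nonneg (((θ - Real.pi : ℝ) : ℂ) ^ (-(1 / 2) : ℂ)))
  have g3 := mul_nonneg hK (norm_nonneg (((θ + Real.pi : ℝ) : ℂ) ^ (-(1 / 2) : ℂ)))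
  unfold bnd
  rw [mul_add, mul_add]
  rcases le_or_gt |θ| (Real.pi / 2) with h | h
  · have := sin_rpow_le h h0
    exact ⟨this.1, by linarith [this.2]⟩
  · rcases lt_abs.1 h with h | h
    · have := sin_rpow_le (t := θ - Real.pi) (abs_le.2 ⟨by linarith, by linarith⟩)
        (by linarith)
      rw [Real.sin_sub_pi, abs_neg] at this
      exact ⟨this.1, by linarith [this.2]⟩
    · have := sin_rpow_le (t := θ + Real.pi) (abs_le.2 ⟨by linarith, by linarith⟩)
        (by linarith)
      rw [Real.sin_add_pi, abs_neg] at this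
      exact ⟨this.1, by linarith [this.2]⟩

lemma ae_good : ∀ᵐ θ : ℝ, θ ∈ Set.uIoc (-Real.pi) Real.pi →
    -Real.pi < θ ∧ θ < Real.pi ∧ θ ≠ 0 := by
  have h1 : ∀ᵐ θ : ℝ, θ ≠ 0 := Measure.ae_ne volume 0
  have h2 : ∀ᵐ θ : ℝ, θ ≠ Real.pi := Measure.ae_ne volume _
  filter_upwards [h1, h2] with θ a b h
  rw [Set.uIoc_of_le (by linarith [Real.pi_pos])] at h
  exact ⟨h.1, lt_of_le_of_ne h.2 b, a⟩

lemma mem_slit {r : ℝ} (h0 : 0 ≤ r) (h1 : r ≤ 1) (θ : ℝ)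
    (h : 1 - r * Complex.exp (-2 * Complex.I * (θ : ℂ)) ≠ 0) :
    1 - r * Complex.exp (-2 * Complex.I * (θ : ℂ)) ∈ Complex.slitPlane := by
  set w := r * Complex.exp (-2 * Complex.I * (θ : ℂ)) with hw
  have hn : ‖w‖ ≤ 1 := by
    rw [hw, norm_mul, norm_e]; simpa [abs_of_nonneg h0] using h1
  rw [Complex.mem_slitPlane_iff_not_le_zero]
  intro hle
  have := Complex.le_def.1 hle
  have h2 : (1 : ℝ) ≤ w.re := by simpa using this.1
  have h3 : w.im = 0 := by simpa using this.2
  have h4 : w.re = 1 := le_antisymm ((Complex.re_le_norm w).trans hn) h2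
  apply h
  apply Complex.ext <;> simp [h3, h4]

lemma limit_aux (n : ℕ) :
    Tendsto (fun r : ℝ => ∫ θ in (-Real.pi)..Real.pi, Complex.exp (2 * Complex.I * n * (θ : ℂ)) *
      (1 - r * Complex.exp (-2 * Complex.I * (θ : ℂ))) ^ (-(1 / 2) : ℂ)) (𝓝[<] 1)
      (𝓝 (∫ θ in (-Real.pi)..Real.pi, Complex.exp (2 * Complex.I * n * (θ : ℂ)) *
      (1 - Complex.exp (-2 * Complex.I * (θ : ℂ))) ^ (-(1 / 2) : ℂ))) := by
  have hev : ∀ᶠ r : ℝ in 𝓝[<] 1, 0 ≤ r ∧ r < 1 := by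
    filter_upwards [Ioo_mem_nhdsLT (show (0 : ℝ) < 1 by norm_num)] with r hr
    exact ⟨hr.1.le, hr.2⟩
  apply intervalIntegral.tendsto_integral_filter_of_dominated_convergence bnd
  · refine Eventually.of_forall fun r => Measurable.aestronglyMeasurable ?_
    fun_prop
  · filter_upwards [hev] with r hr
    filter_upwards [ae_good] with θ hθ hm
    obtain ⟨a, b, c⟩ := hθ hm
    obtain ⟨hs, hb⟩ := sin_bnd a b c
    rw [norm_mul, Complex.norm_exp]
    have h3 : (2 * Complex.I * n * (θ : ℂ)).re = 0 := by simp
    rw [h3, Real.exp_zero, one_mul]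
    refine le_trans ?_ hb
    have := Complex.norm_cpow_real (1 - r * Complex.exp (-2 * Complex.I * (θ : ℂ))) (-(1 / 2))
    push_cast at this
    rw [this]
    exact Real.rpow_le_rpow_of_nonpos hs (norm_ge θ hr.1 hr.2.le) (by norm_num)
  · exact bnd_int _ _
  · filter_upwards [ae_good] with θ hθ hm
    obtain ⟨a, b, c⟩ := hθ hm
    obtain ⟨hs, hb⟩ := sin_bnd a b c
    apply Tendsto.const_mul
    have hne : 1 - ((1 : ℝ) : ℂ) * Complex.exp (-2 * Complex.I * (θ : ℂ)) ≠ 0 := by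
      rw [← norm_pos_iff]
      exact hs.trans_le (norm_ge θ zero_le_one le_rfl)
    have hsl := mem_slit zero_le_one le_rfl θ hne
    have hc : ContinuousAt (fun r : ℝ =>
        (1 - (r : ℂ) * Complex.exp (-2 * Complex.I * (θ : ℂ))) ^ (-(1 / 2) : ℂ)) 1 :=
      ContinuousAt.cpow (by fun_prop) continuousAt_const hsl
    have := hc.tendsto.mono_left (nhdsWithin_le_nhds (s := Set.Iio 1))
    simpa using this

theorem H0_eval_centralBinom (n : ℕ) :
    H0 (-(2 * n)) 0 = (Nat.centralBinom n : ℂ) / 4 ^ n := by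
  have h1 := limit_aux n
  have h2 : Tendsto (fun r : ℝ => 2 * (Real.pi : ℂ) * ((Nat.centralBinom n : ℂ) / 4 ^ n * r ^ n))
      (𝓝[<] 1) (𝓝 (2 * (Real.pi : ℂ) * ((Nat.centralBinom n : ℂ) / 4 ^ n))) := by
    have hc : Continuous (fun r : ℝ =>
      2 * (Real.pi : ℂ) * ((Nat.centralBinom n : ℂ) / 4 ^ n * r ^ n)) := by fun_prop
    have := (hc.tendsto 1).mono_left (nhdsWithin_le_nhds (s := Set.Iio 1))
    simpa using this
  have hev : ∀ᶠ r : ℝ in 𝓝[<] 1, 0 ≤ r ∧ r < 1 := by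
    filter_upwards [Ioo_mem_nhdsLT (show (0 : ℝ) < 1 by norm_num)] with r hr
    exact ⟨hr.1.le, hr.2⟩
  have h3 := tendsto_nhds_unique (h1.congr' (by
    filter_upwards [hev] with r hr
    exact integral_r n hr.1 hr.2)) h2
  have hp : (Real.pi : ℂ) ≠ 0 := by exact_mod_cast Real.pi_ne_zero
  unfold H0
  have h4 : ∀ θ : ℝ, -Complex.I * ((-(2 * n) : ℤ) : ℂ) * (θ : ℂ) = 2 * Complex.I * n * θ := by
    intro θ; push_cast; ring
  simp only [h4, Int.natAbs_zero, pow_zero, one_mul]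
  rw [h3]
  field_simp
end

section
/- For all integers s and k with k ≠ 0, H₀(s+1, k+1) + H₀(s+1, k−1) + H₀(s−1, k+1) + H₀(s−1, k−1) = 4·H₀(s,k). -/
lemma H0aux_g : IntervalIntegrable
    (fun θ : ℝ => ((1 : ℂ) - Complex.exp (-2 * Complex.I * (θ : ℂ))) ^ (-(1 / 2) : ℂ))
    MeasureTheory.volume (-Real.pi) Real.pi := by
  have hper : Function.Periodic
      (fun θ : ℝ => ((1 : ℂ) - Complex.exp (-2 * Complex.I * (θ : ℂ))) ^ (-(1 / 2) : ℂ))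
      Real.pi := by
    intro θ
    have h : -2 * Complex.I * ((θ + Real.pi : ℝ) : ℂ)
        = -2 * Complex.I * (θ : ℂ) - 2 * Real.pi * Complex.I := by
      push_cast; ring
    simp only [h, Complex.exp_sub, Complex.exp_two_pi_mul_I, div_one]
  refine hper.intervalIntegrable (t := -(Real.pi / 2)) Real.pi_pos.ne' ?_ _ _
  have hc : IntervalIntegrable (fun x : ℝ => (x : ℂ) ^ (-(1 / 2) : ℂ))
      MeasureTheory.volume (-(Real.pi / 2)) (-(Real.pi / 2) + Real.pi) :=
    intervalIntegral.intervalIntegrable_cpow' (by norm_num)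
  refine hc.mono_fun ?_ ?_
  · apply Measurable.aestronglyMeasurable
    fun_prop
  · refine (MeasureTheory.ae_restrict_iff' measurableSet_uIoc).2 (Filter.Eventually.of_forall ?_)
    intro θ hθ
    rw [Set.uIoc_of_le (by linarith [Real.pi_pos])] at hθ
    obtain ⟨h1, h2⟩ := hθ
    have he : (-(1 / 2) : ℂ) = ((-(1 / 2) : ℝ) : ℂ) := by push_cast; rfl
    simp only [he, Complex.norm_cpow_real]
    by_cases h0 : θ = 0
    · subst h0; simp
    have hnorm : ‖(1 : ℂ) - Complex.exp (-2 * Complex.I * (θ : ℂ))‖ = 2 * |Real.sin θ| := by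
      have : (1 : ℂ) - Complex.exp (-2 * Complex.I * (θ : ℂ))
          = Complex.exp ((-θ : ℝ) * Complex.I) * (2 * Complex.I * Complex.sin θ) := by
        have e1 : Complex.exp (-2 * Complex.I * (θ : ℂ))
          = Complex.exp (-θ * Complex.I) * Complex.exp (-θ * Complex.I) := by
          rw [← Complex.exp_add]; ring_nf
        have e2 : Complex.exp (-θ * Complex.I) * Complex.exp (θ * Complex.I) = 1 := by
          rw [← Complex.exp_add]; simp
        rw [e1, Complex.sin]
        push_cast
        linear_combination (-1 : ℂ) * e2 + (Complex.exp (-θ * Complex.I) * Complex.exp (-θ * Complex.I) - Complex.exp (-θ * Complex.I) * Complex.exp (θ * Complex.I)) * (-1 : ℂ) * Complex.I_sq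
      rw [this, norm_mul, Complex.norm_exp_ofReal_mul_I, ← Complex.ofReal_sin]
      simp [-Complex.ofReal_sin, Complex.norm_real]
    rw [hnorm, Complex.norm_real, Real.norm_eq_abs]
    apply Real.rpow_le_rpow_of_nonpos (abs_pos.2 h0) _ (by norm_num)
    have hs := Real.mul_abs_le_abs_sin (x := θ) (abs_le.2 ⟨h1.le, by linarith⟩)
    have : (1 : ℝ) / 2 ≤ 2 / Real.pi := by
      rw [div_le_div_iff₀ (by norm_num) Real.pi_pos]; linarith [Real.pi_le_four]
    nlinarith [abs_nonneg θ]

lemma H0aux_int (s : ℤ) (n : ℕ) : IntervalIntegrable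
    (fun θ : ℝ => ((Real.cos θ / (1 + |Real.sin θ|) : ℝ) : ℂ) ^ n *
        Complex.exp (-Complex.I * (s : ℂ) * (θ : ℂ)) *
        ((1 : ℂ) - Complex.exp (-2 * Complex.I * (θ : ℂ))) ^ (-(1 / 2) : ℂ))
    MeasureTheory.volume (-Real.pi) Real.pi := by
  refine H0aux_g.continuousOn_mul (Continuous.continuousOn ?_)
  have : Continuous fun θ : ℝ => Real.cos θ / (1 + |Real.sin θ|) :=
    Real.continuous_cos.div (by fun_prop) (fun θ => by positivity)
  fun_prop

lemma H0aux_C (θ : ℝ) (n : ℕ) :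
    (((Real.cos θ / (1 + |Real.sin θ|) : ℝ) : ℂ) ^ (n + 2)
      + ((Real.cos θ / (1 + |Real.sin θ|) : ℝ) : ℂ) ^ n) * (2 * Complex.cos θ)
      = 4 * ((Real.cos θ / (1 + |Real.sin θ|) : ℝ) : ℂ) ^ (n + 1) := by
  have h : ((Real.cos θ / (1 + |Real.sin θ|)) ^ 2 + 1) * Real.cos θ
      = 2 * (Real.cos θ / (1 + |Real.sin θ|)) := by
    have hp : (1 + |Real.sin θ|) ≠ 0 := by positivity
    field_simp
    have := Real.sin_sq_add_cos_sq θ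
    have := sq_abs (Real.sin θ)
    grind
  have hC := congrArg (fun x : ℝ => (x : ℂ)) h
  simp only [Complex.ofReal_mul, Complex.ofReal_add, Complex.ofReal_pow, Complex.ofReal_one,
    Complex.ofReal_cos, Complex.ofReal_ofNat] at hC
  generalize ((Real.cos θ / (1 + |Real.sin θ|) : ℝ) : ℂ) = c at *
  linear_combination 2 * c ^ n * hC

lemma H0aux_E (s : ℤ) (θ : ℝ) :
    Complex.exp (-Complex.I * ((s + 1 : ℤ) : ℂ) * (θ : ℂ))
      + Complex.exp (-Complex.I * ((s - 1 : ℤ) : ℂ) * (θ : ℂ))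
      = 2 * Complex.cos θ * Complex.exp (-Complex.I * (s : ℂ) * (θ : ℂ)) := by
  rw [Complex.two_cos, add_mul, ← Complex.exp_add, ← Complex.exp_add, add_comm]
  push_cast
  ring_nf

lemma H0aux_main (s : ℤ) (a b c : ℤ) (n : ℕ) (ha : a.natAbs = n + 2) (hb : b.natAbs = n)
    (hc : c.natAbs = n + 1) :
    H0 (s + 1) a + H0 (s + 1) b + H0 (s - 1) a + H0 (s - 1) b = 4 * H0 s c := by
  unfold H0
  rw [ha, hb, hc, mul_left_comm 4, ← mul_add, ← mul_add, ← mul_add]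
  congr 1
  rw [← intervalIntegral.integral_add (H0aux_int _ _) (H0aux_int _ _),
    ← intervalIntegral.integral_add ((H0aux_int _ _).add (H0aux_int _ _)) (H0aux_int _ _),
    ← intervalIntegral.integral_add (((H0aux_int _ _).add (H0aux_int _ _)).add (H0aux_int _ _))
      (H0aux_int _ _),
    ← intervalIntegral.integral_const_mul]
  congr 1
  funext θ
  have h1 := H0aux_C θ n
  have h2 := H0aux_E s θ
  generalize ((1 : ℂ) - Complex.exp (-2 * Complex.I * (θ : ℂ))) ^ (-(1 / 2) : ℂ) = g
  generalize ((Real.cos θ / (1 + |Real.sin θ|) : ℝ) : ℂ) = C at *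
  linear_combination (C ^ (n + 2) + C ^ n) * g * h2
    + Complex.exp (-Complex.I * (s : ℂ) * (θ : ℂ)) * g * h1

theorem H0_discrete_harmonic_off_axis (s k : ℤ) (hk : k ≠ 0) :
    H0 (s + 1) (k + 1) + H0 (s + 1) (k - 1) + H0 (s - 1) (k + 1) + H0 (s - 1) (k - 1)
      = 4 * H0 s k := by
  rcases lt_or_gt_of_ne hk with h | h
  · rw [← H0aux_main s (k - 1) (k + 1) k (k.natAbs - 1) (by omega) (by omega) (by omega)]
    ring
  · exact H0aux_main s (k + 1) (k - 1) k (k.natAbs - 1) (by omega) (by omega) (by omega)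
end

section
/- For every ε > 0 there exists a natural number S such that for all integers s and k with |s| ≥ S, ‖H₀(s,k)‖ ≤ ε. (The bound is uniform in k.) -/
open MeasureTheory Filter Topology Set in
theorem H0aux_norm (θ : ℝ) :
    ‖((1 : ℂ) - Complex.exp (-2 * Complex.I * (θ : ℂ))) ^ (-(1 / 2) : ℂ)‖
      = (2 * |Real.sin θ|) ^ (-(1 / 2) : ℝ) := by
  have h1 : (-(1 / 2) : ℂ) = ((-(1 / 2) : ℝ) : ℂ) := by push_cast; ring
  rw [h1, Complex.norm_cpow_real]
  congr 1
  have h2 : (1 : ℂ) - Complex.exp (-2 * Complex.I * (θ : ℂ))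
      = Complex.exp ((-θ : ℝ) * Complex.I) * (2 * Complex.I * ((Real.sin θ : ℝ) : ℂ)) := by
    have e1 : Complex.exp (-2 * Complex.I * (θ : ℂ))
        = Complex.exp ((-θ : ℝ) * Complex.I) * Complex.exp (-(θ : ℂ) * Complex.I) := by
      rw [← Complex.exp_add]; congr 1; push_cast; ring
    have e2 : (1 : ℂ) = Complex.exp ((-θ : ℝ) * Complex.I) * Complex.exp ((θ : ℂ) * Complex.I) := by
      rw [← Complex.exp_add, ← Complex.exp_zero]; congr 1; push_cast; ring
    rw [e1]
    conv_lhs => rw [e2]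
    rw [← mul_sub]
    congr 1
    push_cast
    rw [Complex.sin]
    linear_combination (-(Complex.exp (-(θ : ℂ) * Complex.I) - Complex.exp ((θ : ℂ) * Complex.I))) * Complex.I_sq
  rw [h2, norm_mul, Complex.norm_exp_ofReal_mul_I, norm_mul, norm_mul, Complex.norm_I,
    Complex.norm_real]
  simp

open MeasureTheory Filter Topology Set in
theorem H0aux_int_s10 (a b : ℝ) : IntervalIntegrable
    (fun θ : ℝ => (2 * |Real.sin θ|) ^ (-(1 / 2) : ℝ)) volume a b := by
  have hm : Measurable (fun θ : ℝ => (2 * |Real.sin θ|) ^ (-(1 / 2) : ℝ)) := by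
    have : Measurable (fun θ : ℝ => (2 * |Real.sin θ|)) := by
      apply Continuous.measurable; fun_prop
    exact this.pow_const _
  have h0 : IntervalIntegrable (fun θ : ℝ => (2 * |Real.sin θ|) ^ (-(1 / 2) : ℝ)) volume 0
      (Real.pi / 2) := by
    have hb : IntervalIntegrable (fun θ : ℝ => θ ^ (-(1 / 2) : ℝ)) volume 0 (Real.pi / 2) :=
      intervalIntegral.intervalIntegrable_rpow' (by norm_num)
    refine hb.mono_fun hm.aestronglyMeasurable ?_
    rw [Filter.EventuallyLE, ae_restrict_iff' measurableSet_uIoc]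
    refine Eventually.of_forall fun θ hθ => ?_
    rw [uIoc_of_le (by positivity)] at hθ
    have h1 := Real.mul_le_sin hθ.1.le hθ.2
    have h3 : θ ≤ 2 * |Real.sin θ| := by
      have := le_abs_self (Real.sin θ)
      have : θ ≤ 2 * (2 / Real.pi * θ) := by
        have h4 : (1 : ℝ) ≤ 2 * (2 / Real.pi) := by
          rw [← mul_div_assoc, le_div_iff₀ Real.pi_pos]; linarith [Real.pi_le_four]
        nlinarith [hθ.1]
      linarith
    rw [Real.norm_of_nonneg (by positivity), Real.norm_of_nonneg (Real.rpow_nonneg hθ.1.le _)]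
    exact Real.rpow_le_rpow_of_nonpos hθ.1 h3 (by norm_num)
  have h1 : IntervalIntegrable (fun θ : ℝ => (2 * |Real.sin θ|) ^ (-(1 / 2) : ℝ)) volume
      (-(Real.pi / 2)) 0 := by
    have := (h0.comp_sub_left 0).symm
    simpa using this
  have hp : Function.Periodic (fun θ : ℝ => (2 * |Real.sin θ|) ^ (-(1 / 2) : ℝ)) Real.pi := by
    intro x; simp [Real.sin_add_pi]
  refine hp.intervalIntegrable Real.pi_ne_zero (t := -(Real.pi / 2)) ?_ a b
  convert h1.trans h0 using 1; ring

theorem H0aux_C_s10 (θ : ℝ) : |Real.cos θ / (1 + |Real.sin θ|)| ≤ 1 := by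
  have := abs_nonneg (Real.sin θ)
  rw [abs_div, abs_of_pos (by linarith : 0 < 1 + |Real.sin θ|), div_le_one (by linarith)]
  linarith [Real.abs_cos_le_one θ]

theorem H0aux_C' (θ : ℝ) (h : Real.sin θ ≠ 0) : |Real.cos θ / (1 + |Real.sin θ|)| < 1 := by
  have := abs_pos.2 h
  rw [abs_div, abs_of_pos (by linarith : 0 < 1 + |Real.sin θ|), div_lt_one (by linarith)]
  linarith [Real.abs_cos_le_one θ]

open MeasureTheory Filter Topology Set in
theorem H0aux_ae : ∀ᵐ θ : ℝ, Real.sin θ ≠ 0 := by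
  have : {θ : ℝ | Real.sin θ = 0}.Countable := by
    have h : {θ : ℝ | Real.sin θ = 0} ⊆ range (fun n : ℤ => (n : ℝ) * Real.pi) := by
      intro θ hθ
      exact Real.sin_eq_zero_iff.1 hθ
    exact (countable_range _).mono h
  have := this.ae_notMem volume
  simpa using this

open MeasureTheory Filter Topology Set in
theorem H0aux_lim : Tendsto (fun n : ℕ => ∫ θ in (-Real.pi)..Real.pi,
    |Real.cos θ / (1 + |Real.sin θ|)| ^ n * (2 * |Real.sin θ|) ^ (-(1 / 2) : ℝ)) atTop (𝓝 0) := by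
  have := intervalIntegral.tendsto_integral_filter_of_dominated_convergence
    (μ := volume) (a := -Real.pi) (b := Real.pi) (l := atTop)
    (F := fun (n : ℕ) (θ : ℝ) => |Real.cos θ / (1 + |Real.sin θ|)| ^ n *
      (2 * |Real.sin θ|) ^ (-(1 / 2) : ℝ)) (f := fun _ => (0 : ℝ))
    (fun θ : ℝ => (2 * |Real.sin θ|) ^ (-(1 / 2) : ℝ)) ?_ ?_ (H0aux_int_s10 _ _) ?_
  · simpa using this
  · refine Eventually.of_forall fun n => Measurable.aestronglyMeasurable ?_
    have h1 : Measurable (fun θ : ℝ => (2 * |Real.sin θ|)) := by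
      apply Continuous.measurable; fun_prop
    have h2 : Measurable (fun θ : ℝ => |Real.cos θ / (1 + |Real.sin θ|)| ^ n) := by
      apply Continuous.measurable
      have : ∀ θ : ℝ, 1 + |Real.sin θ| ≠ 0 := fun θ => by positivity
      fun_prop (disch := assumption)
    exact h2.mul (h1.pow_const _)
  · refine Eventually.of_forall fun n => Eventually.of_forall fun θ _ => ?_
    rw [Real.norm_of_nonneg (by positivity)]
    exact mul_le_of_le_one_left (by positivity) (pow_le_one₀ (abs_nonneg _) (H0aux_C_s10 θ))
  · filter_upwards [H0aux_ae] with θ hθ _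
    simpa using (tendsto_pow_atTop_nhds_zero_of_lt_one (abs_nonneg _) (H0aux_C' θ hθ)).mul_const
      ((2 * |Real.sin θ|) ^ (-(1 / 2) : ℝ))

theorem H0aux_pre (z : ℂ) : ‖(1 / (2 * (Real.pi : ℂ))) * z‖ ≤ ‖z‖ := by
  rw [norm_mul]
  refine mul_le_of_le_one_left (norm_nonneg _) ?_
  rw [norm_div, norm_mul, Complex.norm_real, Real.norm_of_nonneg Real.pi_pos.le]
  simp only [norm_one, Complex.norm_ofNat]
  rw [div_le_one (by positivity)]
  linarith [Real.pi_gt_three]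

theorem H0aux_bound (s k : ℤ) : ‖H0 s k‖ ≤ ∫ θ in (-Real.pi)..Real.pi,
    |Real.cos θ / (1 + |Real.sin θ|)| ^ k.natAbs * (2 * |Real.sin θ|) ^ (-(1 / 2) : ℝ) := by
  refine (H0aux_pre _).trans ?_
  refine (intervalIntegral.norm_integral_le_integral_norm (by linarith [Real.pi_pos])).trans
    (le_of_eq ?_)
  congr 1
  ext θ
  rw [norm_mul, norm_mul, H0aux_norm, norm_pow, Complex.norm_real, Real.norm_eq_abs]
  have : -Complex.I * (s : ℂ) * (θ : ℂ) = ((-s * θ : ℝ) : ℂ) * Complex.I := by push_cast; ring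
  rw [this, Complex.norm_exp_ofReal_mul_I, mul_one]

open MeasureTheory Filter Topology Set in
theorem H0aux_RL (f : ℝ → ℂ) : Tendsto (fun s : ℤ => ∫ θ in (-Real.pi)..Real.pi,
    Complex.exp (-Complex.I * (s : ℂ) * (θ : ℂ)) * f θ) cofinite (𝓝 0) := by
  have h := Real.tendsto_integral_exp_smul_cocompact ((Ioc (-Real.pi) Real.pi).indicator f)
  have h2 : Tendsto (fun s : ℤ => (s : ℝ) * (1 / (2 * Real.pi))) cofinite (cocompact ℝ) := by
    have h3 : Tendsto (fun s : ℤ => (s : ℝ)) cofinite (cocompact ℝ) := Int.tendsto_coe_cofinite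
    exact (Homeomorph.mulRight₀ (1 / (2 * Real.pi)) (by positivity)).isClosedEmbedding.tendsto_cocompact.comp h3
  refine (h.comp h2).congr fun s => ?_
  simp only [Function.comp]
  rw [intervalIntegral.integral_of_le (by linarith [Real.pi_pos]),
    ← integral_indicator measurableSet_Ioc]
  congr 1
  ext θ
  by_cases hθ : θ ∈ Ioc (-Real.pi) Real.pi
  · rw [indicator_of_mem hθ, indicator_of_mem hθ, Circle.smul_def, Real.fourierChar_apply,
      smul_eq_mul]
    congr 2
    have : (Real.pi : ℂ) ≠ 0 := by exact_mod_cast Real.pi_ne_zero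
    push_cast
    field_simp
  · rw [indicator_of_notMem hθ, indicator_of_notMem hθ, smul_zero]

open MeasureTheory Filter Topology Set in
theorem H0_uniform_decay_horizontal (ε : ℝ) (hε : 0 < ε) :
    ∃ S : ℕ, ∀ s k : ℤ, (S : ℤ) ≤ |s| → ‖H0 s k‖ ≤ ε := by
  obtain ⟨K, hK⟩ := eventually_atTop.1 (H0aux_lim.eventually_lt_const hε)
  have hn : ∀ n : ℕ, ∃ S : ℕ, ∀ s k : ℤ, k.natAbs = n → (S : ℤ) ≤ |s| → ‖H0 s k‖ ≤ ε := by
    intro n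
    have h := H0aux_RL (fun θ => ((Real.cos θ / (1 + |Real.sin θ|) : ℝ) : ℂ) ^ n *
      ((1 : ℂ) - Complex.exp (-2 * Complex.I * (θ : ℂ))) ^ (-(1 / 2) : ℂ))
    have h' := h.norm
    rw [norm_zero] at h'
    have h2 := h'.eventually_lt_const hε
    rw [eventually_cofinite] at h2
    obtain ⟨B, hB⟩ := (h2.image Int.natAbs).bddAbove
    refine ⟨B + 1, fun s k hk hs => ?_⟩
    by_contra hcon
    have hmem : s.natAbs ≤ B := by
      apply hB
      refine ⟨s, ?_, rfl⟩
      intro hlt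
      apply hcon
      refine (H0aux_pre _).trans (le_trans (le_of_eq ?_) hlt.le)
      rw [hk]
      congr 2
      ext θ
      ring
    rw [Int.abs_eq_natAbs] at hs
    omega
  choose S hS using hn
  refine ⟨(Finset.range K).sup S, fun s k hs => ?_⟩
  by_cases hk : K ≤ k.natAbs
  · exact (H0aux_bound s k).trans (hK _ hk).le
  · refine hS k.natAbs s k rfl (le_trans ?_ hs)
    exact_mod_cast Finset.le_sup (f := S) (Finset.mem_range.2 (not_le.1 hk))
end

section
/- Let C : ℝ → ℝ be defined by C(θ) = cos θ/(1 + |sin θ|). Then for every natural number k ≥ 1, ∫_0^π k · |C(θ)|^{k−1} · |deriv C θ| dθ ≤ 4. -/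
/-- The function `C(θ) = cos θ / (1 + |sin θ|)` from the slit-plane harmonic measure. -/
noncomputable def slitC (θ : ℝ) : ℝ := Real.cos θ / (1 + |Real.sin θ|)

lemma slit_aux_deriv (x : ℝ) (h : 0 ≤ Real.sin x) :
    HasDerivAt (fun θ => Real.cos θ / (1 + Real.sin θ)) (-(1 / (1 + Real.sin x))) x := by
  have h1 : 1 + Real.sin x ≠ 0 := by positivity
  have h2 := (Real.hasDerivAt_cos x).div ((Real.hasDerivAt_sin x).const_add 1) h1
  refine h2.congr_deriv ?_
  field_simp
  nlinarith [Real.sin_sq_add_cos_sq x]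

theorem integral_slitC_pow_deriv_le_four (k : ℕ) (hk : 1 ≤ k) :
    (∫ θ in (0 : ℝ)..Real.pi, (k : ℝ) * |slitC θ| ^ (k - 1) * |deriv slitC θ|) ≤ 4 := by
  have hpi := Real.pi_pos
  set g : ℝ → ℝ := fun θ => Real.cos θ / (1 + Real.sin θ) with hg
  set H : ℝ → ℝ := fun θ => (k : ℝ) * |g θ| ^ (k - 1) * (1 / (1 + Real.sin θ)) with hH
  have hs : ∀ x ∈ Set.Icc 0 Real.pi, 0 ≤ Real.sin x := fun x hx =>
    Real.sin_nonneg_of_mem_Icc hx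
  have hcong : (∫ θ in (0 : ℝ)..Real.pi, (k : ℝ) * |slitC θ| ^ (k - 1) * |deriv slitC θ|)
      = ∫ θ in (0 : ℝ)..Real.pi, H θ := by
    rw [intervalIntegral.integral_of_le hpi.le, intervalIntegral.integral_of_le hpi.le,
      MeasureTheory.integral_Ioc_eq_integral_Ioo, MeasureTheory.integral_Ioc_eq_integral_Ioo]
    refine MeasureTheory.setIntegral_congr_fun measurableSet_Ioo ?_
    intro x hx
    have hx0 := Real.sin_pos_of_mem_Ioo hx
    have he : slitC =ᶠ[nhds x] g := by
      filter_upwards [isOpen_Ioo.mem_nhds hx] with y hy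
      simp only [slitC, hg, abs_of_pos (Real.sin_pos_of_mem_Ioo hy)]
    have hd : deriv slitC x = -(1 / (1 + Real.sin x)) := by
      rw [he.deriv_eq]; exact (slit_aux_deriv x hx0.le).deriv
    have : 0 ≤ 1 / (1 + Real.sin x) := by positivity
    simp only [hH, hd, he.eq_of_nhds, abs_neg, abs_of_nonneg this]
  have hgc : ContinuousOn g (Set.Icc 0 Real.pi) := fun x hx =>
    (slit_aux_deriv x (hs x hx)).continuousAt.continuousWithinAt
  have hHc : ContinuousOn H (Set.Icc 0 Real.pi) := by
    refine ContinuousOn.mul (continuousOn_const.mul (hgc.abs.pow _)) ?_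
    refine continuousOn_const.div (by fun_prop) ?_
    intro x hx
    have := hs x hx
    positivity
  have i1 : IntervalIntegrable H MeasureTheory.volume 0 (Real.pi / 2) := by
    apply ContinuousOn.intervalIntegrable
    rw [Set.uIcc_of_le (by linarith)]
    exact hHc.mono (Set.Icc_subset_Icc le_rfl (by linarith))
  have i2 : IntervalIntegrable H MeasureTheory.volume (Real.pi / 2) Real.pi := by
    apply ContinuousOn.intervalIntegrable
    rw [Set.uIcc_of_le (by linarith)]
    exact hHc.mono (Set.Icc_subset_Icc (by linarith) le_rfl)
  have hk0 : k ≠ 0 := by omega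
  have e1 : (∫ θ in (0 : ℝ)..(Real.pi / 2), H θ) = 1 := by
    rw [intervalIntegral.integral_eq_sub_of_hasDerivAt (f := fun θ => -(g θ) ^ k) _ i1]
    · simp [hg, hk0]
    · intro x hx
      rw [Set.uIcc_of_le (by linarith)] at hx
      have h0 := hs x ⟨hx.1, by linarith [hx.2]⟩
      have hc : 0 ≤ Real.cos x := Real.cos_nonneg_of_mem_Icc ⟨by linarith [hx.1], hx.2⟩
      have hgx : 0 ≤ g x := by simp only [hg]; positivity
      refine ((slit_aux_deriv x h0).pow k).neg.congr_deriv ?_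
      simp only [hH, abs_of_nonneg hgx]
      simp only [hg]
      ring
  have e2 : (∫ θ in (Real.pi / 2)..Real.pi, H θ) = 1 := by
    rw [intervalIntegral.integral_eq_sub_of_hasDerivAt (f := fun θ => (-(g θ)) ^ k) _ i2]
    · simp [hg, hk0]
    · intro x hx
      rw [Set.uIcc_of_le (by linarith)] at hx
      have h0 := hs x ⟨by linarith [hx.1], hx.2⟩
      have hc : Real.cos x ≤ 0 :=
        Real.cos_nonpos_of_pi_div_two_le_of_le hx.1 (by linarith [hx.2])
      have hgx : g x ≤ 0 := by
        simp only [hg]; exact div_nonpos_of_nonpos_of_nonneg hc (by positivity)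
      refine ((slit_aux_deriv x h0).neg.pow k).congr_deriv ?_
      simp only [hH, abs_of_nonpos hgx]
      simp [hg]
  rw [hcong, ← intervalIntegral.integral_add_adjacent_intervals i1 i2, e1, e2]
  norm_num
end

section
/- Let n be a natural number and μ a real number. For all functions B, D : Fin n → ℝ taking values in {−1, 1}, the sum over all functions B′ : Fin n → ℝ taking values in {−1, 1} of (∏_{i : B i = −1} (μ − B′ i)) · (−1)^{card{i : (D i)·(B′ i) = −1}} · (∏_{i : D i = 1} (μ + B′ i)) equals 2^n if B = D and equals 0 otherwise. -/
open Finset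

theorem EP_mul_PE_eq_two_pow (n : ℕ) (μ : ℝ) (B D : Fin n → ℝ)
    (hB : ∀ i, B i = -1 ∨ B i = 1) (hD : ∀ i, D i = -1 ∨ D i = 1) :
    (∑ B' ∈ Fintype.piFinset (fun _ : Fin n => ({-1, 1} : Finset ℝ)),
        (∏ i ∈ univ.filter (fun i => B i = -1), (μ - B' i)) *
          ((-1 : ℝ) ^ (univ.filter (fun i => D i * B' i = -1)).card *
            ∏ i ∈ univ.filter (fun i => D i = 1), (μ + B' i))) =
      if B = D then 2 ^ n else 0 := by
  have key : ∀ i, ∑ b ∈ ({-1, 1} : Finset ℝ), ((if B i = -1 then (μ - b) else 1) *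
      ((if D i * b = -1 then (-1 : ℝ) else 1) * (if D i = 1 then (μ + b) else 1))) =
      if B i = D i then 2 else 0 := by
    intro i
    rw [Finset.sum_pair (by norm_num)]
    rcases hB i with h | h <;> rcases hD i with h' | h' <;> rw [h, h'] <;> norm_num <;> ring
  have h1 : ∀ B' : Fin n → ℝ, (∏ i ∈ univ.filter (fun i => B i = -1), (μ - B' i)) *
          ((-1 : ℝ) ^ (univ.filter (fun i => D i * B' i = -1)).card *
            ∏ i ∈ univ.filter (fun i => D i = 1), (μ + B' i)) =
      ∏ i, ((if B i = -1 then (μ - B' i) else 1) *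
      ((if D i * B' i = -1 then (-1 : ℝ) else 1) * (if D i = 1 then (μ + B' i) else 1))) := by
    intro B'
    rw [Finset.prod_mul_distrib, Finset.prod_mul_distrib, ← Finset.prod_filter,
      ← Finset.prod_filter, ← Finset.prod_filter, Finset.prod_const]
  rw [Finset.sum_congr rfl (fun B' _ => h1 B')]
  rw [← Finset.prod_univ_sum (fun _ : Fin n => ({-1, 1} : Finset ℝ))
    (fun i b => (if B i = -1 then (μ - b) else 1) *
      ((if D i * b = -1 then (-1 : ℝ) else 1) * (if D i = 1 then (μ + b) else 1)))]
  rw [Finset.prod_congr rfl (fun i _ => key i)]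
  split_ifs with h
  · subst h
    simp
  · obtain ⟨i, hi⟩ := Function.ne_iff.mp h
    exact Finset.prod_eq_zero (Finset.mem_univ i) (if_neg hi)
end

section
/- Let n be a natural number, μ a real number, and p any real-valued function on the set of sign vectors Fin n → {−1, 1}. For each sign vector D define E(D) := Σ_{B′} p(B′) · ∏_{i : D i = −1} (μ − B′ i), the sum being over all sign vectors B′. Then for every sign vector B, p(B) = 2^{−n} · Σ_{D} (−1)^{card{i : (D i)·(B i) = −1}} · (∏_{i : D i = 1} (μ + B i)) · E(D), the sum being over all sign vectors D. -/
open Finset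

theorem pattern_probability_inversion (n : ℕ) (μ : ℝ) (p : (Fin n → ℝ) → ℝ)
    (B : Fin n → ℝ) (hB : ∀ i, B i = -1 ∨ B i = 1)
    (E : (Fin n → ℝ) → ℝ)
    (hE : ∀ D : Fin n → ℝ, E D =
      ∑ B' ∈ Fintype.piFinset (fun _ : Fin n => ({-1, 1} : Finset ℝ)),
        p B' * ∏ i ∈ univ.filter (fun i => D i = -1), (μ - B' i)) :
    p B = ((2 : ℝ) ^ n)⁻¹ *
      ∑ D ∈ Fintype.piFinset (fun _ : Fin n => ({-1, 1} : Finset ℝ)),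
        (-1 : ℝ) ^ (univ.filter (fun i => D i * B i = -1)).card *
          (∏ i ∈ univ.filter (fun i => D i = 1), (μ + B i)) * E D := by
  have key : ∀ B' ∈ Fintype.piFinset (fun _ : Fin n => ({-1, 1} : Finset ℝ)),
      ∑ D ∈ Fintype.piFinset (fun _ : Fin n => ({-1, 1} : Finset ℝ)),
        (-1 : ℝ) ^ (univ.filter (fun i => D i * B i = -1)).card *
          (∏ i ∈ univ.filter (fun i => D i = 1), (μ + B i)) *
          (p B' * ∏ i ∈ univ.filter (fun i => D i = -1), (μ - B' i))
      = if B' = B then (2 : ℝ) ^ n * p B else 0 := by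
    intro B' hB'
    have hB2 : ∀ i, B' i = -1 ∨ B' i = 1 := by
      intro i
      have := (Fintype.mem_piFinset.1 hB') i
      simpa using this
    have h1 : ∀ D : Fin n → ℝ,
        (-1 : ℝ) ^ (univ.filter (fun i => D i * B i = -1)).card *
          (∏ i ∈ univ.filter (fun i => D i = 1), (μ + B i)) *
          (p B' * ∏ i ∈ univ.filter (fun i => D i = -1), (μ - B' i))
        = p B' * ∏ i, ((if D i * B i = -1 then (-1 : ℝ) else 1) *
            (if D i = 1 then (μ + B i) else 1) * (if D i = -1 then (μ - B' i) else 1)) := by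
      intro D
      rw [Finset.prod_mul_distrib, Finset.prod_mul_distrib, ← Finset.prod_filter,
        ← Finset.prod_filter, ← Finset.prod_filter, Finset.prod_const]
      ring
    rw [Finset.sum_congr rfl (fun D _ => h1 D), ← Finset.mul_sum,
      ← Finset.prod_univ_sum (fun _ : Fin n => ({-1, 1} : Finset ℝ))
        (fun i d => (if d * B i = -1 then (-1 : ℝ) else 1) *
            (if d = 1 then (μ + B i) else 1) * (if d = -1 then (μ - B' i) else 1))]
    have h2 : ∀ i, ∑ d ∈ ({-1, 1} : Finset ℝ), ((if d * B i = -1 then (-1 : ℝ) else 1) *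
            (if d = 1 then (μ + B i) else 1) * (if d = -1 then (μ - B' i) else 1))
        = if B' i = B i then 2 else 0 := by
      intro i
      rw [Finset.sum_pair (by norm_num)]
      rcases hB i with h | h <;> rcases hB2 i with h' | h' <;> rw [h, h'] <;> norm_num <;> ring
    rw [Finset.prod_congr rfl (fun i _ => h2 i)]
    split_ifs with h
    · subst h
      simp [mul_comm]
    · obtain ⟨i, hi⟩ := Function.ne_iff.1 h
      rw [Finset.prod_eq_zero (Finset.mem_univ i) (if_neg hi), mul_zero]
  have hmem : B ∈ Fintype.piFinset (fun _ : Fin n => ({-1, 1} : Finset ℝ)) := by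
    rw [Fintype.mem_piFinset]
    intro i
    simpa using hB i
  simp only [hE]
  rw [Finset.sum_congr rfl (fun D _ => Finset.mul_sum _ _ _), Finset.sum_comm,
    Finset.sum_congr rfl key, Finset.sum_ite_eq' _ B, if_pos hmem, ← mul_assoc,
    inv_mul_cancel₀ (by positivity), one_mul]
end
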